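/- arXiv:1808.10368 — 2 statements merged into one kernel-verified Lean document; each statement's English description precedes it below -/
import Mathlib

section
/- Let p₀ ≥ 1 be an integer and let P(u,s) be real-analytic on a neighborhood of (0,0) with P(0,0) = 0 and ∂_s^{p₀} P(0,0) = 0. Then there exist ε > 0, C > 0, and positive integers J, K₀, C₁ (all depending on P and p₀) such that: for all λ ≠ 0, all integers j ≤ −J, k ≤ −K₀, and m with k ≤ m − C₁, all y, t ∈ ℝ with 2^{m−1} ≤ |y| ≤ 2^{m+1} and 2^{k−1} ≤ |y − t| ≤ 2^{k+1}, and every C^∞ function Φ supported in {1/2 ≤ |s| ≤ 2} with |Φ| ≤ 1 and |Φ′| ≤ 1, one has | ∫_ℝ e^{2πi λ (2 y s^{p₀} + P(y−t, s))} 2^{−j} Φ(2^{−j} s) ds | ≤ C ( |λ| 2^{m} 2^{p₀ j} )^{−ε}. -/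
open MeasureTheory Real

noncomputable section

open Set in
theorem exists_mul_abs_sub_le_abs {a b L : ℝ} (hab : a ≤ b) {g g' : ℝ → ℝ}
    (hg : ∀ x ∈ Icc a b, HasDerivAt g (g' x) x) (hL : ∀ x ∈ Icc a b, L ≤ |g' x|) :
    ∃ c ∈ Icc a b, ∀ x ∈ Icc a b, L * |x - c| ≤ |g x| := by
  have hcont : ContinuousOn g (Icc a b) := fun x hx => (hg x hx).continuousAt.continuousWithinAt
  obtain ⟨c, hc, hmin⟩ := isCompact_Icc.exists_isMinOn (nonempty_Icc.2 hab) hcont.abs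
  refine ⟨c, hc, fun x hx => ?_⟩
  have hcx : |g c| ≤ |g x| := hmin hx
  have hsub : uIcc c x ⊆ Icc a b := uIcc_subset_Icc hc hx
  have hmvt : L * |x - c| ≤ |g x - g c| := by
    rcases lt_trichotomy c x with h | h | h
    · obtain ⟨ξ, hξ, he⟩ := exists_hasDerivAt_eq_slope g g' h
        (hcont.mono (Icc_subset_Icc hc.1 hx.2))
        (fun z hz => hg z ⟨hc.1.trans hz.1.le, hz.2.le.trans hx.2⟩)
      have hne : x - c ≠ 0 := (sub_pos.2 h).ne'
      have := hL ξ ⟨hc.1.trans hξ.1.le, hξ.2.le.trans hx.2⟩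
      rw [eq_div_iff hne] at he
      rw [← he, abs_mul]
      gcongr
    · simp [h]
    · obtain ⟨ξ, hξ, he⟩ := exists_hasDerivAt_eq_slope g g' h
        (hcont.mono (Icc_subset_Icc hx.1 hc.2))
        (fun z hz => hg z ⟨hx.1.trans hz.1.le, hz.2.le.trans hc.2⟩)
      have hne : c - x ≠ 0 := (sub_pos.2 h).ne'
      have := hL ξ ⟨hx.1.trans hξ.1.le, hξ.2.le.trans hc.2⟩
      rw [eq_div_iff hne] at he
      rw [abs_sub_comm x, abs_sub_comm (g x), ← he, abs_mul]
      gcongr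
  refine hmvt.trans ?_
  by_contra! hlt
  have hzero : (0 : ℝ) ∈ uIcc (g c) (g x) := by
    rw [mem_uIcc]
    by_contra! hcon
    rcases le_total 0 (g c) with h0 | h0 <;> rcases le_total 0 (g x) with h1 | h1
    · rw [abs_of_nonneg h0, abs_of_nonneg h1] at hcx
      rw [abs_of_nonneg h1, abs_of_nonneg (by linarith)] at hlt
      linarith
    · have := hcon.2 h1; linarith
    · have := hcon.1 h0; linarith
    · rw [abs_of_nonpos h0, abs_of_nonpos h1] at hcx
      rw [abs_of_nonpos h1, abs_of_nonpos (by linarith)] at hlt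
      linarith
  obtain ⟨z, hz, hz0⟩ := intermediate_value_uIcc (hcont.mono hsub) hzero
  have h1 : |g c| ≤ |g z| := hmin (hsub hz)
  rw [hz0, abs_zero] at h1
  have : g c = 0 := abs_nonpos_iff.1 h1
  simp [this] at hlt

open Set in
theorem norm_integral_exp_le_of_le_abs_deriv {a b L K : ℝ} (hab : a ≤ b) (hL : 0 < L)
    {f : ℕ → ℝ → ℝ} (hf : ∀ i, ∀ x ∈ Icc a b, HasDerivAt (f i) (f (i + 1) x) x)
    (hlow : ∀ x ∈ Icc a b, L ≤ |f 1 x|)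
    (hK : ∫ x in a..b, |f 2 x| / f 1 x ^ 2 ≤ K) :
    ‖∫ x in a..b, Complex.exp (Complex.I * f 0 x)‖ ≤ 2 / L + K := by
  have hne : ∀ x ∈ Icc a b, f 1 x ≠ 0 := fun x hx h => by
    have := hlow x hx
    rw [h, abs_zero] at this
    linarith
  have hcont : ∀ i, ContinuousOn (f i) (Icc a b) :=
    fun i x hx => (hf i x hx).continuousAt.continuousWithinAt
  have hcontC : ∀ i, ContinuousOn (fun x => (f i x : ℂ)) (Icc a b) :=
    fun i => Complex.continuous_ofReal.comp_continuousOn (hcont i)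
  have hu : ∀ x ∈ uIcc a b, HasDerivAt (fun x => (Complex.I * (f 1 x : ℂ))⁻¹)
      (-(Complex.I * (f 2 x : ℂ)) / (Complex.I * (f 1 x : ℂ)) ^ 2) x := fun x hx => by
    rw [uIcc_of_le hab] at hx
    have h := ((hf 1 x hx).ofReal_comp.const_mul Complex.I)
    exact h.inv (mul_ne_zero Complex.I_ne_zero (by exact_mod_cast hne x hx))
  have hv : ∀ x ∈ uIcc a b, HasDerivAt (fun x => Complex.exp (Complex.I * f 0 x))
      (Complex.exp (Complex.I * f 0 x) * (Complex.I * (f 1 x : ℂ))) x := fun x hx => by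
    rw [uIcc_of_le hab] at hx
    exact ((hf 0 x hx).ofReal_comp.const_mul Complex.I).cexp
  have hexp : ContinuousOn (fun x => Complex.exp (Complex.I * f 0 x)) (Icc a b) :=
    (continuousOn_const.mul (hcontC 0)).cexp
  have hu'c : ContinuousOn
      (fun x => -(Complex.I * (f 2 x : ℂ)) / (Complex.I * (f 1 x : ℂ)) ^ 2) (Icc a b) := by
    refine ((continuousOn_const.mul (hcontC 2)).neg).div
      ((continuousOn_const.mul (hcontC 1)).pow 2) fun x hx => ?_
    exact pow_ne_zero _ (mul_ne_zero Complex.I_ne_zero (by exact_mod_cast hne x hx))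
  have hibp := intervalIntegral.integral_mul_deriv_eq_deriv_mul hu hv
    (hu'c.intervalIntegrable_of_Icc hab)
    ((hexp.mul (continuousOn_const.mul (hcontC 1))).intervalIntegrable_of_Icc hab)
  have hlhs : ∫ x in a..b, Complex.exp (Complex.I * f 0 x) =
      ∫ x in a..b, (Complex.I * (f 1 x : ℂ))⁻¹ *
        (Complex.exp (Complex.I * f 0 x) * (Complex.I * (f 1 x : ℂ))) := by
    refine intervalIntegral.integral_congr fun x hx => ?_
    rw [uIcc_of_le hab] at hx
    have h1 : (f 1 x : ℂ) ≠ 0 := by exact_mod_cast hne x hx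
    have := Complex.I_ne_zero
    field_simp
  have hnorm : ∀ x, ‖Complex.exp (Complex.I * f 0 x)‖ = 1 := fun x => by
    rw [mul_comm]; exact Complex.norm_exp_ofReal_mul_I _
  have hbd : ∀ x ∈ Icc a b,
      ‖(Complex.I * (f 1 x : ℂ))⁻¹ * Complex.exp (Complex.I * f 0 x)‖ ≤ 1 / L := fun x hx => by
    rw [norm_mul, hnorm, norm_inv, norm_mul, Complex.norm_I, Complex.norm_real, Real.norm_eq_abs,
      one_mul, mul_one, inv_eq_one_div]
    exact one_div_le_one_div_of_le hL (hlow x hx)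
  rw [hlhs, hibp]
  have hrem : ‖∫ x in a..b, -(Complex.I * (f 2 x : ℂ)) / (Complex.I * (f 1 x : ℂ)) ^ 2 *
      Complex.exp (Complex.I * f 0 x)‖ ≤ K := by
    refine (intervalIntegral.norm_integral_le_integral_norm hab).trans (le_of_eq_of_le ?_ hK)
    refine intervalIntegral.integral_congr fun x _ => ?_
    simp only [norm_mul, norm_div, norm_neg, norm_pow, Complex.norm_I, Complex.norm_real,
      Real.norm_eq_abs, hnorm, one_mul, mul_one, sq_abs]
  calc _ ≤ _ := norm_sub_le _ _
    _ ≤ (1 / L + 1 / L) + K := by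
      gcongr
      exact (norm_sub_le _ _).trans
        (add_le_add (hbd b (right_mem_Icc.2 hab)) (hbd a (left_mem_Icc.2 hab)))
    _ = 2 / L + K := by ring

open Set in
theorem integral_abs_deriv_div_sq_le {a b L : ℝ} (hab : a ≤ b) (hL : 0 < L) {f : ℕ → ℝ → ℝ}
    (hf : ∀ i, ∀ x ∈ Icc a b, HasDerivAt (f i) (f (i + 1) x) x)
    (hlow : ∀ x ∈ Icc a b, L ≤ |f 1 x|)
    (hsign : (∀ x ∈ Icc a b, 0 ≤ f 2 x) ∨ ∀ x ∈ Icc a b, f 2 x ≤ 0) :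
    ∫ x in a..b, |f 2 x| / f 1 x ^ 2 ≤ 2 / L := by
  have hne : ∀ x ∈ Icc a b, f 1 x ≠ 0 := fun x hx h => by
    have := hlow x hx
    rw [h, abs_zero] at this
    linarith
  have hcont : ∀ i, ContinuousOn (f i) (Icc a b) :=
    fun i x hx => (hf i x hx).continuousAt.continuousWithinAt
  have hftc : ∫ x in a..b, -f 2 x / f 1 x ^ 2 = (f 1 b)⁻¹ - (f 1 a)⁻¹ := by
    refine intervalIntegral.integral_eq_sub_of_hasDerivAt (f := fun x => (f 1 x)⁻¹)
      (fun x hx => ?_) ?_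
    · rw [uIcc_of_le hab] at hx
      exact (hf 1 x hx).inv (hne x hx)
    · exact ((hcont 2).neg.div ((hcont 1).pow 2)
        fun x hx => pow_ne_zero _ (hne x hx)).intervalIntegrable_of_Icc hab
  have hinv : ∀ x ∈ Icc a b, |(f 1 x)⁻¹| ≤ 1 / L := fun x hx => by
    rw [abs_inv, inv_eq_one_div]
    exact one_div_le_one_div_of_le hL (hlow x hx)
  have ha := abs_le.1 (hinv a (left_mem_Icc.2 hab))
  have hb := abs_le.1 (hinv b (right_mem_Icc.2 hab))
  have h2 : 2 / L = 1 / L + 1 / L := by ring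
  rcases hsign with h | h
  · have : ∫ x in a..b, |f 2 x| / f 1 x ^ 2 = -∫ x in a..b, -f 2 x / f 1 x ^ 2 := by
      rw [← intervalIntegral.integral_neg]
      refine intervalIntegral.integral_congr fun x hx => ?_
      rw [uIcc_of_le hab] at hx
      simp only [abs_of_nonneg (h x hx)]
      ring
    rw [this, hftc]
    linarith [ha.1, ha.2, hb.1, hb.2]
  · have : ∫ x in a..b, |f 2 x| / f 1 x ^ 2 = ∫ x in a..b, -f 2 x / f 1 x ^ 2 := by
      refine intervalIntegral.integral_congr fun x hx => ?_
      rw [uIcc_of_le hab] at hx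
      simp only [abs_of_nonpos (h x hx)]
    rw [this, hftc]
    linarith [ha.1, ha.2, hb.1, hb.2]

open Set in
theorem constant_sign_of_le_abs {a b L : ℝ} (hL : 0 < L) {g : ℝ → ℝ}
    (hg : ContinuousOn g (Icc a b)) (hlow : ∀ x ∈ Icc a b, L ≤ |g x|) :
    (∀ x ∈ Icc a b, 0 ≤ g x) ∨ ∀ x ∈ Icc a b, g x ≤ 0 := by
  by_contra! hcon
  obtain ⟨⟨x, hx, hx0⟩, z, hz, hz0⟩ := hcon
  have hsub : uIcc x z ⊆ Icc a b := uIcc_subset_Icc hx hz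
  obtain ⟨w, hw, hw0⟩ := intermediate_value_uIcc (hg.mono hsub)
    (mem_uIcc.2 (Or.inl ⟨hx0.le, hz0.le⟩) : (0 : ℝ) ∈ uIcc (g x) (g z))
  have := hlow w (hsub hw)
  rw [hw0, abs_zero] at this
  linarith

open Set in
/-- If order-`k` bounds hold for phases whose `(k + 1)`-st derivative has constant sign, then
order-`(k + 1)` bounds hold with no sign condition. -/
theorem van_der_corput_succ {k : ℕ} (hk : 1 ≤ k) {C : ℝ} (hC0 : 0 ≤ C)
    (hC : ∀ (a b L : ℝ), a ≤ b → 0 < L → ∀ f : ℕ → ℝ → ℝ,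
      (∀ i, ∀ x ∈ Icc a b, HasDerivAt (f i) (f (i + 1) x) x) →
      (∀ x ∈ Icc a b, L ≤ |f k x|) →
      ((∀ x ∈ Icc a b, 0 ≤ f (k + 1) x) ∨ ∀ x ∈ Icc a b, f (k + 1) x ≤ 0) →
      ‖∫ x in a..b, Complex.exp (Complex.I * f 0 x)‖ ≤ C * L ^ (-(1 / (k : ℝ))))
    {a b L : ℝ} (hab : a ≤ b) (hL : 0 < L) {f : ℕ → ℝ → ℝ}
    (hf : ∀ i, ∀ x ∈ Icc a b, HasDerivAt (f i) (f (i + 1) x) x)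
    (hlow : ∀ x ∈ Icc a b, L ≤ |f (k + 1) x|) :
    ‖∫ x in a..b, Complex.exp (Complex.I * f 0 x)‖ ≤
      (2 * C + 2) * L ^ (-(1 / ((k + 1 : ℕ) : ℝ))) := by
  have hcont : ∀ i, ContinuousOn (f i) (Icc a b) :=
    fun i x hx => (hf i x hx).continuousAt.continuousWithinAt
  have hexp : ContinuousOn (fun x => Complex.exp (Complex.I * f 0 x)) (Icc a b) :=
    (continuousOn_const.mul (Complex.continuous_ofReal.comp_continuousOn (hcont 0))).cexp
  have hsign := constant_sign_of_le_abs hL (hcont (k + 1)) hlow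
  obtain ⟨c, hc, hcL⟩ := exists_mul_abs_sub_le_abs hab (hf k) hlow
  set δ : ℝ := L ^ (-(1 / ((k + 1 : ℕ) : ℝ))) with hδ
  have hδ0 : 0 < δ := rpow_pos_of_pos hL _
  have hLδ : (L * δ) ^ (-(1 / (k : ℝ))) = δ := by
    have hk0 : (k : ℝ) ≠ 0 := by positivity
    have hk1 : ((k + 1 : ℕ) : ℝ) ≠ 0 := by positivity
    have h1 : L * δ = L ^ (1 + -(1 / ((k + 1 : ℕ) : ℝ))) := by
      rw [rpow_add hL, rpow_one]
    rw [h1, ← rpow_mul hL.le, hδ]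
    congr 1
    push_cast at hk1 ⊢
    field_simp
    ring
  have hpiece : ∀ p q : ℝ, a ≤ p → p ≤ q → q ≤ b → (∀ x ∈ Icc p q, δ ≤ |x - c|) →
      ‖∫ x in p..q, Complex.exp (Complex.I * f 0 x)‖ ≤ C * δ := fun p q hp hpq hq hd => by
    have hsub : Icc p q ⊆ Icc a b := Icc_subset_Icc hp hq
    rw [← hLδ]
    refine hC p q (L * δ) hpq (by positivity) f (fun i x hx => hf i x (hsub hx)) (fun x hx => ?_)
      (hsign.imp (fun h x hx => h x (hsub hx)) fun h x hx => h x (hsub hx))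
    exact (mul_le_mul_of_nonneg_left (hd x hx) hL.le).trans (hcL x (hsub hx))
  have hCδ : 0 ≤ C * δ := by positivity
  have hleft : ‖∫ x in a..max a (c - δ), Complex.exp (Complex.I * f 0 x)‖ ≤ C * δ := by
    rcases le_total (c - δ) a with h | h
    · simpa [max_eq_left h] using hCδ
    · rw [max_eq_right h]
      refine hpiece a (c - δ) le_rfl h (by linarith [hc.2]) fun x hx => ?_
      rw [abs_sub_comm]
      exact (by linarith [hx.2] : δ ≤ c - x).trans (le_abs_self _)
  have hright : ‖∫ x in min b (c + δ)..b, Complex.exp (Complex.I * f 0 x)‖ ≤ C * δ := by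
    rcases le_total b (c + δ) with h | h
    · simpa [min_eq_left h] using hCδ
    · rw [min_eq_right h]
      refine hpiece (c + δ) b (by linarith [hc.1]) h le_rfl fun x hx => ?_
      exact (by linarith [hx.1] : δ ≤ x - c).trans (le_abs_self _)
  have hpc : max a (c - δ) ≤ c := max_le hc.1 (by linarith)
  have hcq : c ≤ min b (c + δ) := le_min hc.2 (by linarith)
  have hmid : ‖∫ x in max a (c - δ)..min b (c + δ), Complex.exp (Complex.I * f 0 x)‖ ≤ 2 * δ := by
    refine (intervalIntegral.norm_integral_le_of_norm_le_const (C := 1) fun x _ => ?_).trans ?_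
    · rw [mul_comm, Complex.norm_exp_ofReal_mul_I]
    · rw [one_mul, abs_of_nonneg (by linarith)]
      linarith [le_max_right a (c - δ), min_le_right b (c + δ)]
  have hint : ∀ p q : ℝ, a ≤ p → p ≤ q → q ≤ b →
      IntervalIntegrable (fun x => Complex.exp (Complex.I * f 0 x)) volume p q :=
    fun p q hp hpq hq =>
      (hexp.mono (Icc_subset_Icc hp hq)).intervalIntegrable_of_Icc hpq
  have hap : a ≤ max a (c - δ) := le_max_left _ _
  have hqb : min b (c + δ) ≤ b := min_le_left _ _
  rw [← intervalIntegral.integral_add_adjacent_intervals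
      (hint a _ le_rfl (hap.trans (hpc.trans hcq)) hqb)
      (hint _ b (hap.trans (hpc.trans hcq)) hqb le_rfl),
    ← intervalIntegral.integral_add_adjacent_intervals
      (hint a _ le_rfl hap (hpc.trans hc.2)) (hint _ _ hap (hpc.trans hcq) hqb)]
  refine (norm_add₃_le).trans ?_
  linarith

open Set in
theorem exists_van_der_corput_of_constant_sign {k : ℕ} (hk : 1 ≤ k) :
    ∃ C : ℝ, 0 ≤ C ∧ ∀ (a b L : ℝ), a ≤ b → 0 < L → ∀ f : ℕ → ℝ → ℝ,
      (∀ i, ∀ x ∈ Icc a b, HasDerivAt (f i) (f (i + 1) x) x) →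
      (∀ x ∈ Icc a b, L ≤ |f k x|) →
      ((∀ x ∈ Icc a b, 0 ≤ f (k + 1) x) ∨ ∀ x ∈ Icc a b, f (k + 1) x ≤ 0) →
      ‖∫ x in a..b, Complex.exp (Complex.I * f 0 x)‖ ≤ C * L ^ (-(1 / (k : ℝ))) := by
  induction k, hk using Nat.le_induction with
  | base =>
    refine ⟨4, by norm_num, fun a b L hab hL f hf hlow hsign => ?_⟩
    refine (norm_integral_exp_le_of_le_abs_deriv hab hL hf hlow
      (integral_abs_deriv_div_sq_le hab hL hf hlow hsign)).trans (le_of_eq ?_)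
    rw [Nat.cast_one, div_one, rpow_neg_one]
    ring
  | succ k hk ih =>
    obtain ⟨C, hC0, hC⟩ := ih
    exact ⟨2 * C + 2, by positivity, fun a b L hab hL f hf hlow _ =>
      van_der_corput_succ hk hC0 hC hab hL hf hlow⟩

open Set in
theorem exists_van_der_corput {k : ℕ} (hk : 2 ≤ k) :
    ∃ C : ℝ, 0 ≤ C ∧ ∀ (a b L : ℝ), a ≤ b → 0 < L → ∀ f : ℕ → ℝ → ℝ,
      (∀ i, ∀ x ∈ Icc a b, HasDerivAt (f i) (f (i + 1) x) x) →
      (∀ x ∈ Icc a b, L ≤ |f k x|) →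
      ‖∫ x in a..b, Complex.exp (Complex.I * f 0 x)‖ ≤ C * L ^ (-(1 / (k : ℝ))) := by
  obtain ⟨l, rfl⟩ : ∃ l, k = l + 1 := ⟨k - 1, by omega⟩
  have hl : 1 ≤ l := by omega
  obtain ⟨C, hC0, hC⟩ := exists_van_der_corput_of_constant_sign hl
  exact ⟨2 * C + 2, by positivity, fun a b L hab hL f hf hlow =>
    van_der_corput_succ hl hC0 hC hab hL hf hlow⟩

open Set in
/-- A van der Corput bound for every order `k ≥ 1`, where the usual monotonicity hypothesis at
`k = 1` is replaced by an upper bound on the next derivative. -/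
theorem exists_van_der_corput_of_abs_le {k : ℕ} (hk : 1 ≤ k) (M : ℝ) (hM : 0 ≤ M) :
    ∃ C : ℝ, 0 ≤ C ∧ ∀ (a b L : ℝ), a ≤ b → b - a ≤ 2 → 0 < L → ∀ f : ℕ → ℝ → ℝ,
      (∀ i, ∀ x ∈ Icc a b, HasDerivAt (f i) (f (i + 1) x) x) →
      (∀ x ∈ Icc a b, L ≤ |f k x|) →
      (∀ x ∈ Icc a b, |f (k + 1) x| ≤ M * L) →
      ‖∫ x in a..b, Complex.exp (Complex.I * f 0 x)‖ ≤ C * L ^ (-(1 / (k : ℝ))) := by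
  rcases hk.eq_or_lt with rfl | hk
  · refine ⟨2 + 2 * M, by positivity, fun a b L hab hba hL f hf hlow hup => ?_⟩
    have hbd : ∫ x in a..b, |f 2 x| / f 1 x ^ 2 ≤ 2 * M / L := by
      have hle : ∀ x ∈ uIoc a b, ‖|f 2 x| / f 1 x ^ 2‖ ≤ M / L := fun x hx => by
        rw [uIoc_of_le hab] at hx
        have hx' := Ioc_subset_Icc_self hx
        have h1 := hlow x hx'
        rw [Real.norm_of_nonneg (by positivity), div_le_div_iff₀ (by
          rw [← sq_abs]; have := hL.trans_le h1; positivity) hL]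
        have h2 : L ^ 2 ≤ f 1 x ^ 2 := by rw [← sq_abs (f 1 x)]; gcongr
        calc |f 2 x| * L ≤ M * L * L := by gcongr; exact hup x hx'
          _ = M * L ^ 2 := by ring
          _ ≤ M * f 1 x ^ 2 := by gcongr
      refine (le_abs_self _).trans
        ((intervalIntegral.norm_integral_le_of_norm_le_const hle).trans ?_)
      rw [abs_of_nonneg (sub_nonneg.2 hab), mul_div_assoc, mul_comm 2]
      rw [mul_comm, mul_comm (M / L)]
      gcongr
    refine (norm_integral_exp_le_of_le_abs_deriv hab hL hf hlow hbd).trans (le_of_eq ?_)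
    rw [Nat.cast_one, div_one, rpow_neg_one]
    ring
  · obtain ⟨C, hC0, hC⟩ := exists_van_der_corput hk
    exact ⟨C, hC0, fun a b L hab _ hL f hf hlow _ => hC a b L hab hL f hf hlow⟩

open Set in
theorem norm_integral_mul_le_of_norm_integral_le {a b K : ℝ} (hab : a ≤ b) {E : ℝ → ℂ}
    (hE : ContinuousOn E (Icc a b)) (hK : ∀ x ∈ Icc a b, ‖∫ s in a..x, E s‖ ≤ K)
    {Φ : ℝ → ℝ} (hΦ : ContDiff ℝ 1 Φ) (hb : ∀ s, |Φ s| ≤ 1 ∧ |deriv Φ s| ≤ 1) :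
    ‖∫ x in a..b, E x * (Φ x : ℂ)‖ ≤ K * (1 + (b - a)) := by
  have hΦd : ∀ x, HasDerivAt (fun x => (Φ x : ℂ)) ((deriv Φ x : ℝ) : ℂ) x := fun x =>
    ((hΦ.differentiable one_ne_zero) x).hasDerivAt.ofReal_comp
  have hint : IntervalIntegrable E volume a b := hE.intervalIntegrable_of_Icc hab
  have hibp := intervalIntegral.integral_mul_deriv_eq_deriv_mul_of_hasDeriv_right
    (a := a) (b := b) (u := fun x => (Φ x : ℂ)) (v := fun x => ∫ s in a..x, E s)
    (u' := fun x => ((deriv Φ x : ℝ) : ℂ)) (v' := E)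
    (fun x _ => (hΦd x).continuousAt.continuousWithinAt)
    (intervalIntegral.continuousOn_primitive_interval (by
      rw [uIcc_of_le hab]; exact hE.integrableOn_Icc))
    (fun x _ => (hΦd x).hasDerivWithinAt)
    (fun x hx => by
      rw [min_eq_left hab, max_eq_right hab] at hx
      refine (intervalIntegral.integral_hasDerivAt_right
        ((hE.mono (Icc_subset_Icc_right hx.2.le)).intervalIntegrable_of_Icc hx.1.le)
        ((hE.mono Ioo_subset_Icc_self).stronglyMeasurableAtFilter isOpen_Ioo x hx)
        (hE.continuousAt (Icc_mem_nhds hx.1 hx.2))).hasDerivWithinAt)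
    ((Complex.continuous_ofReal.comp (hΦ.continuous_deriv le_rfl)).intervalIntegrable _ _) hint
  have hcomm : ∫ x in a..b, E x * (Φ x : ℂ) = ∫ x in a..b, (Φ x : ℂ) * E x := by
    simp only [mul_comm]
  rw [hcomm, hibp]
  have hKb := hK b (right_mem_Icc.2 hab)
  have hK0 : 0 ≤ K := (norm_nonneg _).trans hKb
  have h1 : ‖(Φ b : ℂ) * ∫ s in a..b, E s‖ ≤ K := by
    rw [norm_mul, Complex.norm_real, Real.norm_eq_abs]
    exact (mul_le_of_le_one_left (norm_nonneg _) (hb b).1).trans hKb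
  have h2 : ‖∫ x in a..b, ((deriv Φ x : ℝ) : ℂ) * ∫ s in a..x, E s‖ ≤ K * (b - a) := by
    refine (intervalIntegral.norm_integral_le_of_norm_le_const (C := K) fun x hx => ?_).trans_eq ?_
    · rw [uIoc_of_le hab] at hx
      rw [norm_mul, Complex.norm_real, Real.norm_eq_abs]
      exact (mul_le_of_le_one_left (norm_nonneg _) (hb x).2).trans (hK x (Ioc_subset_Icc_self hx))
    · rw [abs_of_nonneg (sub_nonneg.2 hab)]
  simp only [intervalIntegral.integral_same, mul_zero, sub_zero]
  calc _ ≤ _ := norm_sub_le _ _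
    _ ≤ K + K * (b - a) := add_le_add h1 h2
    _ = K * (1 + (b - a)) := by ring

open Set in
theorem exists_analytic_partial_derivatives {P : ℝ × ℝ → ℝ} (hP : AnalyticAt ℝ P (0, 0)) :
    ∃ (ρ : ℝ) (G : ℕ → ℝ × ℝ → ℝ), 0 < ρ ∧ G 0 = P ∧ (∀ i, AnalyticAt ℝ (G i) (0, 0)) ∧
      ∀ i u s, |u| < ρ → |s| < ρ →
        HasDerivAt (fun s => G i (u, s)) (G (i + 1) (u, s)) s := by
  obtain ⟨ρ, hρ, hball⟩ := hP.exists_ball_analyticOnNhd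
  let G : ℕ → ℝ × ℝ → ℝ := fun i => Nat.rec P (fun _ g z => fderiv ℝ g z (0, 1)) i
  have hG : ∀ i, AnalyticOnNhd ℝ (G i) (Metric.ball (0, 0) ρ) := fun i => by
    induction i with
    | zero => exact hball
    | succ i ih =>
      exact fun z hz => ((ContinuousLinearMap.apply ℝ ℝ ((0 : ℝ), (1 : ℝ))).analyticAt _).comp
        (ih.fderiv z hz)
  refine ⟨ρ, G, hρ, rfl, fun i => hG i _ (Metric.mem_ball_self hρ), fun i u s hu hs => ?_⟩
  have hmem : (u, s) ∈ Metric.ball ((0 : ℝ), (0 : ℝ)) ρ := by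
    simp [Prod.dist_eq, hu, hs]
  have hline : HasDerivAt (fun s : ℝ => (u, s)) ((0 : ℝ), (1 : ℝ)) s :=
    (hasDerivAt_const s u).prodMk (hasDerivAt_id s)
  exact (hG i _ hmem).differentiableAt.hasFDerivAt.comp_hasDerivAt s hline

theorem iteratedDeriv_eq_of_hasDerivAt {ρ : ℝ} {g : ℕ → ℝ → ℝ}
    (hg : ∀ i s, |s| < ρ → HasDerivAt (g i) (g (i + 1) s) s) (i : ℕ) :
    ∀ s, |s| < ρ → iteratedDeriv i (g 0) s = g i s := by
  induction i with
  | zero => simp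
  | succ i ih =>
    intro s hs
    have hev : iteratedDeriv i (g 0) =ᶠ[nhds s] g i := by
      filter_upwards [(isOpen_lt continuous_abs continuous_const).mem_nhds hs] with x hx
      exact ih x hx
    rw [iteratedDeriv_succ, hev.deriv_eq, (hg i s hs).deriv]

/-- A real-analytic germ vanishing at `0` and its Euler derivative are both comparable to one
monomial, the zero germ being covered by `a = 0`. -/
theorem AnalyticAt.exists_monomial_bounds {h : ℝ → ℝ} (hh : AnalyticAt ℝ h 0) (h0 : h 0 = 0) :
    ∃ (a : ℝ) (n : ℕ) (C : ℝ), 0 ≤ a ∧ 1 ≤ C ∧ ∀ᶠ s in nhds (0 : ℝ),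
      |h s| ≤ C * (a * |s| ^ n) ∧ |s * deriv h s| ≤ C * (a * |s| ^ n) ∧
        a * |s| ^ n ≤ C * |s * deriv h s| := by
  by_cases hz : ∀ᶠ s in nhds (0 : ℝ), h s = 0
  · refine ⟨0, 0, 1, le_rfl, le_rfl, ?_⟩
    filter_upwards [hz, hz.eventually_nhds] with s hs hs'
    have hd : deriv h s = 0 := by
      have : h =ᶠ[nhds s] fun _ => 0 := hs'
      rw [this.deriv_eq, deriv_const]
    simp [hs, hd]
  · obtain ⟨n, g, hg, hg0, hfac⟩ := hh.exists_eventuallyEq_pow_smul_nonzero_iff.2 hz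
    simp only [sub_zero, smul_eq_mul] at hfac
    have hn : n ≠ 0 := by
      rintro rfl
      have := hfac.self_of_nhds
      rw [h0, pow_zero, one_mul] at this
      exact hg0 this.symm
    set e : ℝ → ℝ := fun s => n * g s + s * deriv g s with he
    have hec : ContinuousAt e 0 :=
      (continuousAt_const.mul hg.continuousAt).add (continuousAt_id.mul hg.deriv.continuousAt)
    have he0 : e 0 ≠ 0 := by simp [he, hn, hg0]
    have heuler : ∀ᶠ s in nhds (0 : ℝ), s * deriv h s = s ^ n * e s := by
      filter_upwards [hfac.eventually_nhds, hg.eventually_analyticAt] with s hs hgs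
      have hs' : h =ᶠ[nhds s] fun z => z ^ n * g z := hs
      rw [hs'.deriv_eq, ((hasDerivAt_pow n s).fun_mul hgs.differentiableAt.hasDerivAt).deriv, he]
      obtain ⟨l, rfl⟩ := Nat.exists_eq_succ_of_ne_zero hn
      simp only [Nat.succ_eq_add_one, Nat.add_sub_cancel]
      ring
    have hgl := hg.continuousAt.abs.eventually_le_const (lt_add_one |g 0|)
    have heu := hec.abs.eventually_le_const (lt_add_one |e 0|)
    have hel := hec.abs.eventually_const_le (half_lt_self (abs_pos.2 he0))
    refine ⟨1, n, (|g 0| + 1) + (|e 0| + 1) + 2 / |e 0|, zero_le_one, ?_, ?_⟩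
    · have : 0 ≤ 2 / |e 0| := by positivity
      linarith [abs_nonneg (g 0), abs_nonneg (e 0)]
    have hpos : 0 < |e 0| := abs_pos.2 he0
    have hdiv : 0 < 2 / |e 0| := by positivity
    filter_upwards [hfac, heuler, hgl, heu, hel] with s h1 h2 h3 h4 h5
    rw [h1, h2, abs_mul, abs_mul, abs_pow, one_mul]
    have hs : 0 ≤ |s| ^ n := by positivity
    refine ⟨?_, ?_, ?_⟩
    · rw [mul_comm]
      gcongr
      linarith
    · rw [mul_comm]
      gcongr
      linarith [abs_nonneg (g 0)]
    · calc |s| ^ n = 2 / |e 0| * (|s| ^ n * (|e 0| / 2)) := by field_simp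
        _ ≤ _ := by
          gcongr
          linarith [abs_nonneg (g 0), abs_nonneg (e 0)]

theorem exists_abs_sub_le_mul_abs {F : ℝ × ℝ → ℝ} (hF : AnalyticAt ℝ F (0, 0)) :
    ∃ (A r : ℝ), 0 ≤ A ∧ 0 < r ∧ ∀ u s, |u| < r → |s| < r → |F (u, s) - F (0, s)| ≤ A * |u| := by
  obtain ⟨K, t, ht, hlip⟩ := (hF.contDiffAt (n := 1)).exists_lipschitzOnWith
  obtain ⟨r, hr, hsub⟩ := Metric.mem_nhds_iff.1 ht
  refine ⟨K, r, K.2, hr, fun u s hu hs => ?_⟩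
  have := hlip.dist_le_mul (u, s) (hsub (by simp [Prod.dist_eq, hu, hs])) (0, s)
    (hsub (by simp [Prod.dist_eq, hs]))
  simpa [Prod.dist_eq, Real.dist_eq] using this

/-- At scale `r`, either `2 y f + G₀(u, rσ)` is uniformly bounded below by `|y|`, with the rescaled
derivative under control, or the rescaled derivative itself is bounded below by a multiple of
`|y|`. -/
theorem exists_derivative_dichotomy {G₀ G₁ : ℝ × ℝ → ℝ} {ρ : ℝ} (hρ : 0 < ρ)
    (hG₀ : AnalyticAt ℝ G₀ (0, 0)) (hG₁ : AnalyticAt ℝ G₁ (0, 0))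
    (hd : ∀ s, |s| < ρ → HasDerivAt (fun s => G₀ (0, s)) (G₁ (0, s)) s)
    (h0 : G₀ (0, 0) = 0) :
    ∃ κ r₀ η : ℝ, 0 < κ ∧ 0 < r₀ ∧ 0 < η ∧ ∀ r u y f : ℝ, 0 < r → r < r₀ → |u| < r₀ →
      |u| ≤ η * |y| → 1 ≤ f →
      (∀ σ : ℝ, 1 / 2 ≤ |σ| → |σ| ≤ 2 →
        |y| ≤ |2 * y * f + G₀ (u, r * σ)| ∧ |r * G₁ (u, r * σ)| ≤ |y|) ∨
      (∀ σ : ℝ, 1 / 2 ≤ |σ| → |σ| ≤ 2 → κ * |y| ≤ |r * G₁ (u, r * σ)|) := by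
  have hline : AnalyticAt ℝ (fun s : ℝ => ((0 : ℝ), s)) 0 := analyticAt_const.prod analyticAt_id
  have hh : AnalyticAt ℝ (fun s => G₀ (0, s)) 0 := hG₀.comp_of_eq hline rfl
  obtain ⟨a, n, C, ha, hC, hev⟩ := hh.exists_monomial_bounds h0
  obtain ⟨r₁, hr₁, hmono⟩ := Metric.eventually_nhds_iff.1 hev
  obtain ⟨A₀, r₂, hA₀, hr₂, hlip₀⟩ := exists_abs_sub_le_mul_abs hG₀
  obtain ⟨A₁, r₃, hA₁, hr₃, hlip₁⟩ := exists_abs_sub_le_mul_abs hG₁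
  set κ : ℝ := 1 / (16 * C ^ 2 * 4 ^ n) with hκ
  have hκ0 : 0 < κ := by positivity
  set A : ℝ := A₀ + A₁ + 1 with hA
  have hA0 : 0 < A := by positivity
  set η : ℝ := min (1 / 4) κ / A with hη
  have hη0 : 0 < η := by positivity
  set R : ℝ := min (min ρ r₁) (min (min r₂ r₃) 1) with hR
  have hR0 : 0 < R := by positivity
  have hRρ : R ≤ ρ := (min_le_left _ _).trans (min_le_left _ _)
  have hR1 : R ≤ r₁ := (min_le_left _ _).trans (min_le_right _ _)
  have hR2 : R ≤ r₂ := (min_le_right _ _).trans ((min_le_left _ _).trans (min_le_left _ _))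
  have hR3 : R ≤ r₃ := (min_le_right _ _).trans ((min_le_left _ _).trans (min_le_right _ _))
  have hR4 : R ≤ 1 := (min_le_right _ _).trans (min_le_right _ _)
  refine ⟨κ, R / 2, η, hκ0, by positivity, hη0, fun r u y f hr hrR hu huy hf => ?_⟩
  have hAu : A * |u| ≤ min (1 / 4) κ * |y| := by
    calc A * |u| ≤ A * (η * |y|) := by gcongr
      _ = _ := by rw [hη]; field_simp
  have hAu4 : A * |u| ≤ 1 / 4 * |y| :=
    hAu.trans (mul_le_mul_of_nonneg_right (min_le_left _ _) (abs_nonneg _))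
  have hAuκ : A * |u| ≤ κ * |y| :=
    hAu.trans (mul_le_mul_of_nonneg_right (min_le_right _ _) (abs_nonneg _))
  have hA₀u : A₀ * |u| ≤ A * |u| := by gcongr; linarith
  have hA₁u : A₁ * |u| ≤ A * |u| := by gcongr; linarith
  have key : ∀ σ : ℝ, 1 / 2 ≤ |σ| → |σ| ≤ 2 →
      |G₀ (0, r * σ)| ≤ C * (2 ^ n * (a * r ^ n)) ∧
      |r * σ * G₁ (0, r * σ)| ≤ C * (2 ^ n * (a * r ^ n)) ∧
      a * r ^ n ≤ 2 ^ n * C * |r * σ * G₁ (0, r * σ)| ∧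
      |G₀ (u, r * σ) - G₀ (0, r * σ)| ≤ A * |u| ∧
      |r * σ * G₁ (u, r * σ) - r * σ * G₁ (0, r * σ)| ≤ A * |u| := fun σ h1 h2 => by
    have hs : |r * σ| < R := by
      rw [abs_mul, abs_of_pos hr]; nlinarith
    have hu' : |u| < R := by linarith
    obtain ⟨m1, m2, m3⟩ := hmono (y := r * σ) (by rw [dist_zero_right]; exact hs.trans_le hR1)
    rw [(hd _ (hs.trans_le hRρ)).deriv] at m2 m3
    have hup : a * |r * σ| ^ n ≤ 2 ^ n * (a * r ^ n) := by
      rw [abs_mul, abs_of_pos hr, mul_pow]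
      have : |σ| ^ n ≤ 2 ^ n := by gcongr
      calc a * (r ^ n * |σ| ^ n) ≤ a * (r ^ n * 2 ^ n) := by gcongr
        _ = _ := by ring
    have hlo : a * r ^ n ≤ 2 ^ n * (a * |r * σ| ^ n) := by
      rw [abs_mul, abs_of_pos hr, mul_pow]
      have : 1 ≤ 2 ^ n * |σ| ^ n := by
        rw [← mul_pow]; exact one_le_pow₀ (by linarith)
      calc a * r ^ n = a * r ^ n * 1 := by ring
        _ ≤ a * r ^ n * (2 ^ n * |σ| ^ n) := by gcongr
        _ = _ := by ring
    refine ⟨m1.trans (by gcongr), m2.trans (by gcongr), ?_, ?_, ?_⟩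
    · refine hlo.trans ?_
      rw [mul_assoc]
      gcongr
    · exact (hlip₀ u _ (hu'.trans_le hR2) (hs.trans_le hR2)).trans hA₀u
    · rw [← mul_sub, abs_mul]
      refine le_trans ?_ ((hlip₁ u _ (hu'.trans_le hR3) (hs.trans_le hR3)).trans hA₁u)
      exact mul_le_of_le_one_left (abs_nonneg _) (hs.le.trans hR4)
  have hσ : ∀ σ : ℝ, |r * σ * G₁ (u, r * σ)| = |σ| * |r * G₁ (u, r * σ)| := fun σ => by
    rw [← abs_mul]; congr 1; ring
  by_cases hcase : C * (2 ^ n * (a * r ^ n)) ≤ 1 / 4 * |y|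
  · left
    intro σ h1 h2
    obtain ⟨k1, k2, -, k4, k5⟩ := key σ h1 h2
    constructor
    · have hyf : 2 * |y| ≤ |2 * y * f| := by
        rw [abs_mul, abs_mul, abs_two, abs_of_pos (by linarith : 0 < f)]
        exact le_mul_of_one_le_right (by positivity) hf
      have hG : |G₀ (u, r * σ)| ≤ 1 / 2 * |y| := by
        have := abs_sub_abs_le_abs_sub (G₀ (u, r * σ)) (G₀ (0, r * σ))
        linarith
      have := abs_sub_abs_le_abs_sub (2 * y * f) (-G₀ (u, r * σ))
      rw [abs_neg, sub_neg_eq_add] at this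
      linarith [abs_nonneg y]
    · have := abs_sub_abs_le_abs_sub (r * σ * G₁ (u, r * σ)) (r * σ * G₁ (0, r * σ))
      have h3 := hσ σ
      nlinarith [abs_nonneg (r * G₁ (u, r * σ))]
  · right
    intro σ h1 h2
    obtain ⟨-, -, k3, -, k5⟩ := key σ h1 h2
    push Not at hcase
    have hlow : 4 * κ * |y| ≤ |r * σ * G₁ (0, r * σ)| := by
      have hc : 1 / 4 * |y| ≤ C * (2 ^ n * (2 ^ n * C * |r * σ * G₁ (0, r * σ)|)) :=
        hcase.le.trans (by gcongr)
      have h4 : (4 : ℝ) ^ n = 2 ^ n * 2 ^ n := by rw [← mul_pow]; norm_num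
      rw [hκ, h4]
      have hpos : 0 < C ^ 2 * (2 ^ n * 2 ^ n : ℝ) := by positivity
      rw [show 4 * (1 / (16 * C ^ 2 * (2 ^ n * 2 ^ n))) * |y| =
        1 / 4 * |y| / (C ^ 2 * (2 ^ n * 2 ^ n)) by field_simp; norm_num, div_le_iff₀ hpos]
      linarith
    have := abs_sub_abs_le_abs_sub (r * σ * G₁ (0, r * σ)) (r * σ * G₁ (u, r * σ))
    rw [abs_sub_comm] at this
    have h3 := hσ σ
    nlinarith [abs_nonneg (r * G₁ (u, r * σ)), abs_nonneg y]

theorem le_add_mul_rpow_of_le {I T C D : ℝ} {k N : ℕ} (hk : 1 ≤ k) (hkN : k ≤ N) (hD : 0 < D)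
    (hT0 : 0 ≤ T) (hC0 : 0 ≤ C) (hT : I ≤ T) (hC : I ≤ C * D ^ (-(1 / (k : ℝ)))) :
    I ≤ (T + C) * D ^ (-(1 / (N : ℝ))) := by
  have hp : 0 < D ^ (-(1 / (N : ℝ))) := rpow_pos_of_pos hD _
  rcases le_total D 1 with h | h
  · have h1 : 1 ≤ D ^ (-(1 / (N : ℝ))) :=
      one_le_rpow_of_pos_of_le_one_of_nonpos hD h (by rw [neg_nonpos]; positivity)
    calc I ≤ T * 1 := by rwa [mul_one]
      _ ≤ (T + C) * D ^ (-(1 / (N : ℝ))) := by gcongr; linarith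
  · have h1 : D ^ (-(1 / (k : ℝ))) ≤ D ^ (-(1 / (N : ℝ))) := by
      refine rpow_le_rpow_of_exponent_le h (neg_le_neg ?_)
      have : (0 : ℝ) < k := by positivity
      gcongr
    calc I ≤ C * D ^ (-(1 / (k : ℝ))) := hC
      _ ≤ (T + C) * D ^ (-(1 / (N : ℝ))) := by gcongr; linarith

open Set in
theorem norm_integral_exp_mul_le {p : ℕ} (hp : 1 ≤ p) {κ : ℝ} (hκ : 0 < κ) :
    ∃ C : ℝ, 0 < C ∧ ∀ (a b D : ℝ), a ≤ b → b - a ≤ 2 → 0 < D → ∀ f : ℕ → ℝ → ℝ,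
      (∀ i, ∀ x ∈ Icc a b, HasDerivAt (f i) (f (i + 1) x) x) →
      ((∀ x ∈ Icc a b, D ≤ |f p x| ∧ |f (p + 1) x| ≤ D) ∨
        ∀ x ∈ Icc a b, κ * D ≤ |f (p + 1) x|) →
      ∀ Φ : ℝ → ℝ, ContDiff ℝ 1 Φ → (∀ s, |Φ s| ≤ 1 ∧ |deriv Φ s| ≤ 1) →
      ‖∫ x in a..b, Complex.exp (Complex.I * f 0 x) * (Φ x : ℂ)‖ ≤
        C * D ^ (-(1 / ((p + 1 : ℕ) : ℝ))) := by
  obtain ⟨C₁, hC₁, h₁⟩ := exists_van_der_corput_of_abs_le hp 1 zero_le_one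
  obtain ⟨C₂, hC₂, h₂⟩ := exists_van_der_corput (k := p + 1) (by omega)
  set C₃ : ℝ := C₂ * κ ^ (-(1 / ((p + 1 : ℕ) : ℝ))) with hC₃
  have hC₃0 : 0 ≤ C₃ := by positivity
  refine ⟨((2 + C₁) + (2 + C₃)) * 3, by positivity,
    fun a b D hab hba hD f hf hcase Φ hΦ hb => ?_⟩
  have hexp : ContinuousOn (fun x => Complex.exp (Complex.I * f 0 x)) (Icc a b) :=
    (continuousOn_const.mul (Complex.continuous_ofReal.comp_continuousOn
      fun x hx => (hf 0 x hx).continuousAt.continuousWithinAt)).cexp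
  set X : ℝ := D ^ (-(1 / ((p + 1 : ℕ) : ℝ))) with hX
  have hX0 : 0 < X := rpow_pos_of_pos hD _
  have hK : ∀ x ∈ Icc a b, ‖∫ s in a..x, Complex.exp (Complex.I * f 0 s)‖ ≤
      ((2 + C₁) + (2 + C₃)) * X := fun x hx => by
    have hsub : Icc a x ⊆ Icc a b := Icc_subset_Icc_right hx.2
    have hlen : x - a ≤ 2 := by linarith [hx.2]
    have htriv : ‖∫ s in a..x, Complex.exp (Complex.I * f 0 s)‖ ≤ 2 := by
      refine (intervalIntegral.norm_integral_le_of_norm_le_const (C := 1) fun s _ => ?_).trans ?_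
      · rw [mul_comm, Complex.norm_exp_ofReal_mul_I]
      · rw [one_mul, abs_of_nonneg (by linarith [hx.1])]
        exact hlen
    rcases hcase with h | h
    · have hv := h₁ a x D hx.1 hlen hD f (fun i s hs => hf i s (hsub hs))
        (fun s hs => (h s (hsub hs)).1) (fun s hs => by rw [one_mul]; exact (h s (hsub hs)).2)
      refine (le_add_mul_rpow_of_le hp (Nat.le_succ p) hD zero_le_two hC₁ htriv hv).trans ?_
      exact mul_le_mul_of_nonneg_right (by linarith) hX0.le
    · have hv := h₂ a x (κ * D) hx.1 (by positivity) f (fun i s hs => hf i s (hsub hs))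
        (fun s hs => h s (hsub hs))
      rw [mul_rpow hκ.le hD.le, ← mul_assoc] at hv
      refine (le_add_mul_rpow_of_le (by omega) le_rfl hD zero_le_two hC₃0 htriv hv).trans ?_
      exact mul_le_mul_of_nonneg_right (by linarith) hX0.le
  refine (norm_integral_mul_le_of_norm_integral_le hab hexp hK hΦ hb).trans ?_
  calc _ ≤ ((2 + C₁) + (2 + C₃)) * X * 3 := by gcongr; linarith
    _ = _ := by ring

open Set in
theorem norm_integral_le_of_support_annulus {F : ℝ → ℂ} {B : ℝ}
    (hF : ∀ s, F s ≠ 0 → 1 / 2 ≤ |s| ∧ |s| ≤ 2)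
    (hc : ∀ s, 1 / 2 ≤ |s| → |s| ≤ 2 → ContinuousAt F s)
    (hneg : ‖∫ s in (-2 : ℝ)..(-(1 / 2)), F s‖ ≤ B) (hpos : ‖∫ s in (1 / 2 : ℝ)..2, F s‖ ≤ B) :
    ‖∫ s, F s‖ ≤ 2 * B := by
  have hc1 : ContinuousOn F (Icc (-2) (-(1 / 2))) := fun s hs => by
    have h : |s| = -s := abs_of_nonpos (by linarith [hs.2])
    exact (hc s (by linarith [hs.2]) (by linarith [hs.1])).continuousWithinAt
  have hc2 : ContinuousOn F (Icc (1 / 2) 2) := fun s hs => by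
    have h : |s| = s := abs_of_nonneg (by linarith [hs.1])
    exact (hc s (by linarith [hs.1]) (by linarith [hs.2])).continuousWithinAt
  have hsupp : ∀ s, s ∉ Icc (-2 : ℝ) (-(1 / 2)) ∪ Icc (1 / 2) 2 → F s = 0 := fun s hs => by
    by_contra hne
    obtain ⟨h1, h2⟩ := hF s hne
    apply hs
    rcases le_total 0 s with h | h
    · rw [abs_of_nonneg h] at h1 h2
      exact Or.inr ⟨h1, h2⟩
    · rw [abs_of_nonpos h] at h1 h2
      exact Or.inl ⟨by linarith, by linarith⟩
  have hdisj : Disjoint (Icc (-2 : ℝ) (-(1 / 2))) (Icc (1 / 2) 2) :=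
    Set.disjoint_left.2 fun s h1 h2 => by linarith [h1.2, h2.1]
  rw [← setIntegral_eq_integral_of_forall_compl_eq_zero hsupp,
    setIntegral_union hdisj measurableSet_Icc hc1.integrableOn_Icc hc2.integrableOn_Icc,
    integral_Icc_eq_integral_Ioc, integral_Icc_eq_integral_Ioc,
    ← intervalIntegral.integral_of_le (by norm_num), ← intervalIntegral.integral_of_le (by norm_num),
    two_mul]
  exact (norm_add_le _ _).trans (add_le_add hneg hpos)

/-- The successive `σ`-derivatives of `c (2 y (rσ)^p + g₀(rσ))`, where `g` lists the successive
derivatives of `g₀`. -/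
def scaledPhase (p : ℕ) (c r y : ℝ) (g : ℕ → ℝ → ℝ) (i : ℕ) (σ : ℝ) : ℝ :=
  c * r ^ i * (2 * y * (p.descFactorial i * (r * σ) ^ (p - i)) + g i (r * σ))

theorem hasDerivAt_scaledPhase {p : ℕ} {c r y σ : ℝ} {g : ℕ → ℝ → ℝ} {i : ℕ}
    (hg : HasDerivAt (g i) (g (i + 1) (r * σ)) (r * σ)) :
    HasDerivAt (scaledPhase p c r y g i) (scaledPhase p c r y g (i + 1) σ) σ := by
  have hr : HasDerivAt (fun σ : ℝ => r * σ) r σ := by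
    simpa using (hasDerivAt_id σ).const_mul r
  have h := ((((hr.fun_pow (p - i)).const_mul (p.descFactorial i : ℝ)).const_mul (2 * y)).add
    (hg.comp σ hr)).const_mul (c * r ^ i)
  refine h.congr_deriv ?_
  rw [scaledPhase, Nat.descFactorial_succ, Nat.sub_sub]
  push_cast
  ring

theorem exists_scaled_oscillatory_decay {p₀ : ℕ} (hp₀ : 1 ≤ p₀) {P : ℝ × ℝ → ℝ}
    (hP : AnalyticAt ℝ P (0, 0)) (hvan : iteratedDeriv p₀ (fun s => P (0, s)) 0 = 0) :
    ∃ C r₀ η : ℝ, 0 < C ∧ 0 < r₀ ∧ 0 < η ∧ ∀ lam r u y : ℝ, lam ≠ 0 → y ≠ 0 → 0 < r → r < r₀ →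
      |u| < r₀ → |u| ≤ η * |y| →
      ∀ Φ : ℝ → ℝ, ContDiff ℝ 1 Φ → (∀ s : ℝ, Φ s ≠ 0 → 1 / 2 ≤ |s| ∧ |s| ≤ 2) →
        (∀ s : ℝ, |Φ s| ≤ 1 ∧ |deriv Φ s| ≤ 1) →
      ‖∫ σ : ℝ, Complex.exp (2 * (π : ℂ) * Complex.I *
            ((lam * (2 * y * (r * σ) ^ p₀ + P (u, r * σ)) : ℝ) : ℂ)) * (Φ σ : ℂ)‖ ≤
        C * (2 * π * |lam| * r ^ p₀ * |y|) ^ (-(1 / ((p₀ + 1 : ℕ) : ℝ))) := by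
  obtain ⟨ρ, G, hρ, hG0, hG, hGd⟩ := exists_analytic_partial_derivatives hP
  have hG00 : G p₀ (0, 0) = 0 := by
    have h := iteratedDeriv_eq_of_hasDerivAt (g := fun i s => G i (0, s))
      (fun i s hs => hGd i 0 s (by simpa using hρ) hs) p₀ 0 (by simpa using hρ)
    simp only [hG0] at h
    rw [← h, hvan]
  obtain ⟨κ, r₁, η, hκ, hr₁, hη, hdich⟩ := exists_derivative_dichotomy hρ (hG p₀) (hG (p₀ + 1))
    (fun s hs => hGd p₀ 0 s (by simpa using hρ) hs) hG00
  obtain ⟨C, hC, hvdc⟩ := norm_integral_exp_mul_le hp₀ hκ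
  refine ⟨2 * C, min r₁ (ρ / 2), η, by positivity, by positivity, hη,
    fun lam r u y hlam hy hr hrr hu huy Φ hΦ hsupp hb => ?_⟩
  have huρ : |u| < ρ := by linarith [hu.trans_le (min_le_right _ _)]
  have hsρ : ∀ σ : ℝ, |σ| ≤ 2 → |r * σ| < ρ := fun σ hσ => by
    rw [abs_mul, abs_of_pos hr]
    nlinarith [hrr.trans_le (min_le_right _ _)]
  set c : ℝ := 2 * π * lam with hc
  set f := scaledPhase p₀ c r y fun i s => G i (u, s) with hf
  have hfd : ∀ i σ, |σ| ≤ 2 → HasDerivAt (f i) (f (i + 1) σ) σ := fun i σ hσ =>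
    hasDerivAt_scaledPhase (hGd i u _ huρ (hsρ σ hσ))
  have hfp : ∀ σ, f p₀ σ = c * r ^ p₀ * (2 * y * (p₀.factorial : ℝ) + G p₀ (u, r * σ)) :=
    fun σ => by simp [hf, scaledPhase, Nat.descFactorial_self]
  have hfp1 : ∀ σ, f (p₀ + 1) σ = c * r ^ p₀ * (r * G (p₀ + 1) (u, r * σ)) := fun σ => by
    simp only [hf, scaledPhase, Nat.descFactorial_of_lt (Nat.lt_succ_self p₀), pow_succ]
    push_cast
    ring
  set E : ℝ := |c * r ^ p₀| with hE
  have hE0 : 0 < E := by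
    rw [hE, abs_pos]
    positivity
  have hED : 2 * π * |lam| * r ^ p₀ * |y| = E * |y| := by
    rw [hE, hc, abs_mul, abs_mul, abs_mul, abs_two, abs_of_pos pi_pos, abs_of_pos (pow_pos hr _)]
  have hD : 0 < E * |y| := by positivity
  have hint : ∀ a b : ℝ, a ≤ b → b - a ≤ 2 →
      (∀ σ ∈ Set.Icc a b, 1 / 2 ≤ |σ| ∧ |σ| ≤ 2) →
      ‖∫ σ in a..b, Complex.exp (Complex.I * f 0 σ) * (Φ σ : ℂ)‖ ≤
        C * (E * |y|) ^ (-(1 / ((p₀ + 1 : ℕ) : ℝ))) := fun a b hab hba hsub => by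
    refine hvdc a b (E * |y|) hab hba hD f (fun i σ hσ => hfd i σ (hsub σ hσ).2) ?_ Φ hΦ hb
    refine (hdich r u y p₀.factorial hr (hrr.trans_le (min_le_left _ _))
      (hu.trans_le (min_le_left _ _)) huy (by exact_mod_cast p₀.factorial_pos)).imp
      (fun h σ hσ => ?_) fun h σ hσ => ?_
    · obtain ⟨h1, h2⟩ := h σ (hsub σ hσ).1 (hsub σ hσ).2
      rw [hfp, hfp1, abs_mul (c * r ^ p₀), abs_mul (c * r ^ p₀), ← hE]
      exact ⟨mul_le_mul_of_nonneg_left h1 hE0.le, mul_le_mul_of_nonneg_left h2 hE0.le⟩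
    · have h1 := h σ (hsub σ hσ).1 (hsub σ hσ).2
      rw [hfp1, abs_mul, mul_left_comm]
      gcongr
  have hphase : ∀ σ : ℝ, Complex.exp (2 * (π : ℂ) * Complex.I *
      ((lam * (2 * y * (r * σ) ^ p₀ + P (u, r * σ)) : ℝ) : ℂ)) * (Φ σ : ℂ) =
      Complex.exp (Complex.I * f 0 σ) * (Φ σ : ℂ) := fun σ => by
    congr 2
    simp only [hf, hc, scaledPhase, hG0, Nat.descFactorial_zero, pow_zero, Nat.sub_zero]
    push_cast
    ring
  simp only [hphase]
  rw [hED, mul_assoc 2]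
  refine norm_integral_le_of_support_annulus (fun σ hσ => hsupp σ fun h => hσ (by simp [h]))
    (fun σ _ hσ => ?_) (hint _ _ (by norm_num) (by norm_num) fun σ hσ => ?_)
    (hint _ _ (by norm_num) (by norm_num) fun σ hσ => ?_)
  · exact ((hfd 0 σ hσ).ofReal_comp.const_mul Complex.I).cexp.continuousAt.mul
      (Complex.continuous_ofReal.comp hΦ.continuous).continuousAt
  · rw [abs_of_nonpos (by linarith [hσ.2])]
    exact ⟨by linarith [hσ.2], by linarith [hσ.1]⟩
  · rw [abs_of_nonneg (by linarith [hσ.1])]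
    exact hσ

theorem exists_two_zpow_lt {r : ℝ} (hr : 0 < r) :
    ∃ N : ℕ, 0 < N ∧ ∀ j : ℤ, j ≤ -(N : ℤ) → (2 : ℝ) ^ (j + 1) < r := by
  obtain ⟨N, hN⟩ := exists_pow_lt_of_lt_one hr (by norm_num : (1 / 2 : ℝ) < 1)
  refine ⟨N + 1, N.succ_pos, fun j hj => lt_of_le_of_lt ?_ hN⟩
  rw [one_div, inv_pow, ← zpow_natCast, ← zpow_neg]
  exact zpow_le_zpow_right₀ one_le_two (by push_cast at hj; omega)

/-- Let `p₀ ≥ 1` and `P(u,s)` real-analytic near `(0,0)` with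
`P(0,0) = 0` and `∂_s^{p₀} P(0,0) = 0`.  Then there are `ε, C > 0` and positive integers
`J, K₀, C₁` such that for all `λ ≠ 0`, scales `j ≤ -J`, `k ≤ -K₀`, `k ≤ m - C₁`, points
`|y| ∼ 2^m`, `|y−t| ∼ 2^k`, and unit-`C¹` bumps `Φ` supported in `{1/2 ≤ |s| ≤ 2}`,
`|∫ e^{2πi λ(2y s^{p₀} + P(y−t,s))} 2^{-j} Φ(2^{-j}s) ds| ≤ C (|λ| 2^m 2^{p₀ j})^{-ε}`. -/
theorem oscillatory_decay_top_coefficient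
    (p₀ : ℕ) (hp₀ : 1 ≤ p₀) (P : ℝ × ℝ → ℝ)
    (hP : AnalyticAt ℝ P (0, 0)) (hP0 : P (0, 0) = 0)
    (hvan : iteratedDeriv p₀ (fun s => P (0, s)) 0 = 0) :
    ∃ ε C : ℝ, 0 < ε ∧ 0 < C ∧ ∃ J K₀ C₁ : ℕ, 0 < J ∧ 0 < K₀ ∧ 0 < C₁ ∧
      ∀ lam : ℝ, lam ≠ 0 →
      ∀ j k m : ℤ, j ≤ -(J : ℤ) → k ≤ -(K₀ : ℤ) → k ≤ m - (C₁ : ℤ) →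
      ∀ y t : ℝ,
        (2 : ℝ) ^ (m - 1) ≤ |y| → |y| ≤ (2 : ℝ) ^ (m + 1) →
        (2 : ℝ) ^ (k - 1) ≤ |y - t| → |y - t| ≤ (2 : ℝ) ^ (k + 1) →
      ∀ Φ : ℝ → ℝ, ContDiff ℝ (⊤ : ℕ∞) Φ →
        (∀ s : ℝ, Φ s ≠ 0 → 1 / 2 ≤ |s| ∧ |s| ≤ 2) →
        (∀ s : ℝ, |Φ s| ≤ 1 ∧ |deriv Φ s| ≤ 1) →
        ‖∫ s : ℝ, Complex.exp (2 * (π : ℂ) * Complex.I *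
              ((lam * (2 * y * s ^ p₀ + P (y - t, s)) : ℝ) : ℂ)) *
            (((2 : ℝ) ^ (-j) * Φ ((2 : ℝ) ^ (-j) * s) : ℝ) : ℂ)‖
          ≤ C * (|lam| * (2 : ℝ) ^ m * (2 : ℝ) ^ ((p₀ : ℤ) * j)) ^ (-ε) := by
  obtain ⟨C, r₀, η, hC, hr₀, hη, hdecay⟩ := exists_scaled_oscillatory_decay hp₀ hP hvan
  obtain ⟨J, hJ, hJr⟩ := exists_two_zpow_lt hr₀
  obtain ⟨C₁, hC₁, hC₁η⟩ := exists_two_zpow_lt (half_pos hη)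
  refine ⟨1 / ((p₀ + 1 : ℕ) : ℝ), C, by positivity, hC, J, J, C₁, hJ, hJ, hC₁, ?_⟩
  intro lam hlam j k m hj hk hkm y t hym _ _ hyt Φ hΦ hsupp hb
  have hypos : 0 < |y| := lt_of_lt_of_le (by positivity) hym
  have hm : (2 : ℝ) ^ m = 2 * 2 ^ (m - 1) := by
    rw [zpow_sub_one₀ two_ne_zero]; ring
  have hmy : (2 : ℝ) ^ m ≤ 2 * |y| := by rw [hm]; gcongr
  set r : ℝ := 2 ^ j with hr
  have hr0 : 0 < r := by positivity
  have hrr : r < r₀ := by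
    refine lt_of_le_of_lt ?_ (hJr j hj)
    exact zpow_le_zpow_right₀ one_le_two (by omega)
  have hu : |y - t| < r₀ := hyt.trans_lt (hJr k hk)
  have huy : |y - t| ≤ η * |y| := by
    have h1 : (2 : ℝ) ^ (k + 1) = 2 ^ (k - m + 1) * 2 ^ m := by
      rw [← zpow_add₀ two_ne_zero]; congr 1; ring
    calc |y - t| ≤ 2 ^ (k - m + 1) * 2 ^ m := hyt.trans_eq h1
      _ ≤ η / 2 * (2 * |y|) := by
        gcongr
        exact (hC₁η (k - m) (by omega)).le
      _ = η * |y| := by ring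
  have hbound := hdecay lam r (y - t) y hlam (abs_pos.1 hypos) hr0 hrr hu huy Φ
    (hΦ.of_le (by exact_mod_cast le_top)) hsupp hb
  have hscale : ∫ s : ℝ, Complex.exp (2 * (π : ℂ) * Complex.I *
        ((lam * (2 * y * s ^ p₀ + P (y - t, s)) : ℝ) : ℂ)) *
        (((2 : ℝ) ^ (-j) * Φ ((2 : ℝ) ^ (-j) * s) : ℝ) : ℂ) =
      ∫ σ : ℝ, Complex.exp (2 * (π : ℂ) * Complex.I *
        ((lam * (2 * y * (r * σ) ^ p₀ + P (y - t, r * σ)) : ℝ) : ℂ)) * (Φ σ : ℂ) := by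
    have hcv := Measure.integral_comp_mul_left (fun σ : ℝ => Complex.exp (2 * (π : ℂ) * Complex.I *
        ((lam * (2 * y * (r * σ) ^ p₀ + P (y - t, r * σ)) : ℝ) : ℂ)) * (Φ σ : ℂ)) r⁻¹
    rw [inv_inv, abs_of_pos hr0] at hcv
    rw [(eq_inv_smul_iff₀ hr0.ne').2 hcv.symm, ← integral_smul]
    refine integral_congr_ae (Filter.Eventually.of_forall fun s => ?_)
    simp only [mul_inv_cancel_left₀ hr0.ne', zpow_neg, ← hr, Complex.real_smul]
    push_cast
    ring
  rw [hscale]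
  refine hbound.trans ?_
  have hX : 0 < |lam| * (2 : ℝ) ^ m * (2 : ℝ) ^ ((p₀ : ℤ) * j) := by positivity
  have hpow : (2 : ℝ) ^ ((p₀ : ℤ) * j) = r ^ p₀ := by
    rw [hr, mul_comm, zpow_mul, zpow_natCast]
  refine mul_le_mul_of_nonneg_left (rpow_le_rpow_of_nonpos hX ?_ ?_) hC.le
  · rw [hpow]
    calc |lam| * 2 ^ m * r ^ p₀ ≤ |lam| * (2 * |y|) * r ^ p₀ := by gcongr
      _ = 2 * 1 * |lam| * r ^ p₀ * |y| := by ring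
      _ ≤ 2 * π * |lam| * r ^ p₀ * |y| := by gcongr; linarith [pi_gt_three]
  · rw [neg_nonpos]
    positivity
end
end

section
/- Let p₀ ≥ 2 be an integer, let φ and ψ₁, …, ψ_{p₀−1} be real-analytic functions on a neighborhood of 0 ∈ ℝ with φ(0) = 0 and ψ_p(0) = 0 for each p, and fix an index p_r ∈ {1, …, p₀−1} with ψ_{p_r} ≢ 0; let ℓ_r ≥ 1 be the order of vanishing of ψ_{p_r} at 0. Then there exist ε > 0, C > 0, and positive integers J, K₀ (depending on φ, the ψ_p's and p_r) such that: for all λ ∈ ℝ, all integers j ≤ −J and k ≤ −K₀, all u ∈ ℝ with 2^{k−1} ≤ |u| ≤ 2^{k+1}, and every C^∞ function Φ supported in {1/2 ≤ |s| ≤ 2} with |Φ| ≤ 1 and |Φ′| ≤ 1, one has | ∫_ℝ e^{2πi λ ( φ(s) + Σ_{p=1}^{p₀−1} ψ_p(u) s^p )} 2^{−j} Φ(2^{−j} s) ds | ≤ C ( |λ| 2^{ℓ_r k} 2^{p_r j} )^{−ε}. -/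
open MeasureTheory Real
noncomputable section

/-- A function which is small at `2 ^ n` separated points has an `n`-th derivative which is small
somewhere. -/
lemma exists_abs_deriv_le_of_separated {a b d : ℝ} (hd : 0 < d) (n : ℕ) :
    ∀ (D : ℕ → ℝ → ℝ) (x : ℕ → ℝ) (B : ℝ),
      (∀ i < n, ∀ t ∈ Set.Icc a b, HasDerivAt (D i) (D (i + 1) t) t) →
      (∀ i < 2 ^ n, x i ∈ Set.Icc a b) →
      (∀ i, i + 1 < 2 ^ n → x i + d ≤ x (i + 1)) →
      (∀ i < 2 ^ n, |D 0 (x i)| ≤ B) →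
      ∃ ξ ∈ Set.Icc a b, |D n ξ| ≤ (2 / d) ^ n * B := by
  induction n with
  | zero =>
    intro D x B _ hx _ hB
    exact ⟨x 0, hx 0 (by norm_num), by simpa using hB 0 (by norm_num)⟩
  | succ n ih =>
    intro D x B hD hx hsep hB
    have key : ∀ i < 2 ^ n, ∃ y ∈ Set.Ioo (x (2 * i)) (x (2 * i + 1)),
        |D 1 y| ≤ 2 / d * B := by
      intro i hi
      have h1 : 2 * i + 1 < 2 ^ (n + 1) := by rw [pow_succ]; omega
      have hs := hsep (2 * i) h1
      have hsub : Set.Icc (x (2 * i)) (x (2 * i + 1)) ⊆ Set.Icc a b :=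
        Set.Icc_subset_Icc (hx _ (by omega)).1 (hx _ h1).2
      obtain ⟨y, hy, hyd⟩ := exists_hasDerivAt_eq_slope (D 0) (D 1)
        (show x (2 * i) < x (2 * i + 1) by linarith)
        (fun t ht => (hD 0 (by omega) t (hsub ht)).continuousAt.continuousWithinAt)
        (fun t ht => hD 0 (by omega) t (hsub (Set.Ioo_subset_Icc_self ht)))
      refine ⟨y, hy, ?_⟩
      have hpos : 0 < x (2 * i + 1) - x (2 * i) := by linarith
      have hB1 := hB _ h1
      have hB0 := hB (2 * i) (by omega)
      have hnum : |D 0 (x (2 * i + 1)) - D 0 (x (2 * i))| ≤ 2 * B :=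
        (abs_sub _ _).trans (by linarith)
      rw [hyd, abs_div, abs_of_pos hpos, div_mul_eq_mul_div]
      exact div_le_div₀ ((abs_nonneg _).trans hnum) hnum hd (by linarith)
    choose! y hy hyB using key
    have hlt : ∀ i < 2 ^ n, 2 * i + 1 < 2 ^ (n + 1) := fun i hi => by rw [pow_succ]; omega
    obtain ⟨ξ, hξ, hb⟩ := ih (fun i => D (i + 1)) y (2 / d * B)
      (fun i hi => hD (i + 1) (by omega))
      (fun i hi => ⟨(hx (2 * i) (by have := hlt i hi; omega)).1.trans (hy i hi).1.le,
        (hy i hi).2.le.trans (hx _ (hlt i hi)).2⟩)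
      (fun i hi => by
        have h1 := hlt (i + 1) hi
        have h2 := (hy i (by omega)).2
        have h3 := (hy (i + 1) hi).1
        have h4 := hsep (2 * i + 1) (by omega)
        rw [show 2 * i + 1 + 1 = 2 * (i + 1) by ring] at h4
        linarith)
      hyB
    exact ⟨ξ, hξ, hb.trans_eq (by ring)⟩

/-- A set of large outer measure contains many separated points. -/
lemma exists_separated_of_volume {d : ℝ} (hd : 0 < d) (m : ℕ) :
    ∀ S : Set ℝ, BddBelow S → ENNReal.ofReal (2 * m * d) < volume S →
      ∃ x : ℕ → ℝ, (∀ i < m + 1, x i ∈ S) ∧ ∀ i, i + 1 < m + 1 → x i + d ≤ x (i + 1) := by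
  induction m with
  | zero =>
    intro S _ hS
    obtain ⟨y, hy⟩ : S.Nonempty := by
      by_contra h
      rw [Set.not_nonempty_iff_eq_empty] at h
      simp [h] at hS
    exact ⟨fun _ => y, fun _ _ => hy, fun i hi => by omega⟩
  | succ m ih =>
    intro S hb hS
    have hne : S.Nonempty := by
      by_contra h
      rw [Set.not_nonempty_iff_eq_empty] at h
      simp [h] at hS
    obtain ⟨y, hy, hyd⟩ := exists_lt_of_csInf_lt hne (show sInf S < sInf S + d by linarith)
    have hcov : S ⊆ Set.Icc (sInf S) (sInf S + 2 * d) ∪ (S ∩ Set.Ici (y + d)) := by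
      intro t ht
      by_cases h : y + d ≤ t
      · exact Or.inr ⟨ht, h⟩
      · exact Or.inl ⟨csInf_le hb ht, by linarith [not_le.1 h]⟩
    have hvol : ENNReal.ofReal (2 * m * d) < volume (S ∩ Set.Ici (y + d)) := by
      by_contra! h
      have h1 := (measure_mono hcov).trans (measure_union_le (μ := volume) _ _)
      rw [Real.volume_Icc] at h1
      have h2 := h1.trans (add_le_add_right h _)
      rw [← ENNReal.ofReal_add (by linarith) (by positivity)] at h2
      refine absurd hS (not_lt.2 (h2.trans_eq ?_))
      congr 1
      push_cast
      ring
    obtain ⟨x, hxS, hxd⟩ := ih _ (hb.mono Set.inter_subset_left) hvol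
    refine ⟨fun i => Nat.casesOn i y x, ?_, ?_⟩
    · rintro (_ | i) hi
      · exact hy
      · exact (hxS i (by omega)).1
    · rintro (_ | i) hi
      · exact (hxS 0 (by omega)).2
      · exact hxd i (by omega)

/-- The `i`-th derivative of `∑ p < q, c p * t ^ p`. -/
def powSumDeriv (c : ℕ → ℝ) (q i : ℕ) (t : ℝ) : ℝ :=
  ∑ p ∈ Finset.range q, c p * (p.descFactorial i * t ^ (p - i))

lemma powSumDeriv_zero (c : ℕ → ℝ) (q : ℕ) (t : ℝ) :
    powSumDeriv c q 0 t = ∑ p ∈ Finset.range q, c p * t ^ p := by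
  simp [powSumDeriv]

lemma hasDerivAt_powSumDeriv (c : ℕ → ℝ) (q i : ℕ) (t : ℝ) :
    HasDerivAt (powSumDeriv c q i) (powSumDeriv c q (i + 1) t) t := by
  refine HasDerivAt.fun_sum fun p _ => ((((hasDerivAt_pow (p - i) t).const_mul
    (p.descFactorial i : ℝ)).const_mul (c p)).congr_deriv ?_)
  rw [Nat.descFactorial_succ, Nat.sub_sub]
  push_cast
  ring

lemma powSumDeriv_of_le (c : ℕ → ℝ) {q i : ℕ} (h : q ≤ i) (t : ℝ) : powSumDeriv c q i t = 0 := by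
  refine Finset.sum_eq_zero fun p hp => ?_
  rw [Nat.descFactorial_of_lt (by have := Finset.mem_range.1 hp; omega)]
  simp

lemma abs_powSumDeriv_le (c : ℕ → ℝ) (q i : ℕ) {t T : ℝ} (hT : 1 ≤ T) (ht : |t| ≤ T) :
    |powSumDeriv c q i t| ≤ (q ^ i * T ^ q) * ∑ p ∈ Finset.range q, |c p| := by
  rw [Finset.mul_sum]
  refine (Finset.abs_sum_le_sum_abs _ _).trans (Finset.sum_le_sum fun p hp => ?_)
  have hp' := Finset.mem_range.1 hp
  rw [abs_mul, abs_mul, abs_pow, Nat.abs_cast, mul_comm]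
  have h1 : (p.descFactorial i : ℝ) ≤ (q : ℝ) ^ i := by
    exact_mod_cast (Nat.descFactorial_le_pow p i).trans (Nat.pow_le_pow_left hp'.le i)
  have h2 : |t| ^ (p - i) ≤ T ^ q :=
    (pow_le_pow_left₀ (abs_nonneg t) ht _).trans (pow_le_pow_right₀ hT (by omega))
  gcongr

/-- A polynomial which is small at sufficiently many separated points has small coefficients. -/
lemma exists_coeff_bound_of_separated (T : ℝ) (hT : 1 ≤ T) (q : ℕ) : ∃ (C : ℝ) (N : ℕ), 1 ≤ C ∧
    ∀ (n : ℕ) (c x : ℕ → ℝ) (d B : ℝ), q ≤ n → 0 < d → d ≤ 1 →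
      (∀ i < 2 ^ n, |x i| ≤ T) → (∀ i, i + 1 < 2 ^ n → x i + d ≤ x (i + 1)) →
      (∀ i < 2 ^ n, |powSumDeriv c q 0 (x i)| ≤ B) →
      ∀ p < q, |c p| ≤ C / d ^ N * B := by
  induction q with
  | zero => exact ⟨1, 0, le_rfl, fun _ _ _ _ _ _ _ _ _ _ _ p hp => absurd hp (by omega)⟩
  | succ q ih =>
    obtain ⟨C, N, hC, H⟩ := ih
    have hT0 : (0 : ℝ) ≤ T := by linarith
    have hc1 : (1 : ℝ) ≤ 1 + 2 ^ q * T ^ q := by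
      have : (0 : ℝ) ≤ 2 ^ q * T ^ q := by positivity
      linarith
    refine ⟨2 ^ q * (C * (1 + 2 ^ q * T ^ q)), N + q, ?_, ?_⟩
    · exact one_le_mul_of_one_le_of_one_le (one_le_pow₀ (by norm_num))
        (one_le_mul_of_one_le_of_one_le hC hc1)
    intro n c x d B hqn hd hd1 hx hsep hB p hp
    have hpw : 2 ^ q ≤ 2 ^ n := Nat.pow_le_pow_right (by norm_num) (by omega)
    have hB0 : 0 ≤ B := (abs_nonneg _).trans (hB 0 (by positivity))
    obtain ⟨ξ, -, hξ⟩ := exists_abs_deriv_le_of_separated (a := -T) (b := T) hd q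
      (powSumDeriv c (q + 1)) x B (fun i _ t _ => hasDerivAt_powSumDeriv c _ i t)
      (fun i hi => abs_le.1 (hx i (by omega))) (fun i hi => hsep i (by omega))
      (fun i hi => hB i (by omega))
    have htop : powSumDeriv c (q + 1) q ξ = c q * q.factorial := by
      have := powSumDeriv_of_le c (le_refl q) ξ
      unfold powSumDeriv at this ⊢
      rw [Finset.sum_range_succ, this]
      simp [Nat.descFactorial_self]
    have hcq : |c q| ≤ (2 / d) ^ q * B := by
      rw [htop, abs_mul, Nat.abs_cast] at hξ
      refine le_trans (le_mul_of_one_le_right (abs_nonneg _) ?_) hξ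
      exact_mod_cast Nat.one_le_iff_ne_zero.2 q.factorial_ne_zero
    have hdq : 1 ≤ 1 / d ^ q := by
      rw [le_div_iff₀ (by positivity), one_mul]
      exact pow_le_one₀ hd.le hd1
    have hdN : 1 ≤ 1 / d ^ N := by
      rw [le_div_iff₀ (by positivity), one_mul]
      exact pow_le_one₀ hd.le hd1
    have hcq' : |c q| ≤ 2 ^ q * (1 / d ^ q) * B := by
      refine hcq.trans_eq ?_
      rw [div_pow]; ring
    have hfin : 2 ^ q * (C * (1 + 2 ^ q * T ^ q)) / d ^ (N + q) * B
        = 2 ^ q * (C * (1 + 2 ^ q * T ^ q)) * ((1 / d ^ N) * (1 / d ^ q)) * B := by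
      rw [pow_add]; field_simp
    rw [hfin]
    rcases Nat.lt_succ_iff_lt_or_eq.1 hp with hp | rfl
    · have hsmall : ∀ i < 2 ^ n, |powSumDeriv c q 0 (x i)|
          ≤ (1 + 2 ^ q * T ^ q) * (1 / d ^ q) * B := by
        intro i hi
        have h1 : powSumDeriv c q 0 (x i) = powSumDeriv c (q + 1) 0 (x i) - c q * x i ^ q := by
          simp [powSumDeriv_zero, Finset.sum_range_succ]
        rw [h1]
        refine (abs_sub _ _).trans ?_
        rw [abs_mul, abs_pow]
        have h2 : |x i| ^ q ≤ T ^ q := pow_le_pow_left₀ (abs_nonneg _) (hx i hi) q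
        calc _ ≤ (1 / d ^ q) * B + (2 ^ q * (1 / d ^ q) * B) * T ^ q := by
              refine add_le_add ((hB i hi).trans (le_mul_of_one_le_left hB0 hdq)) ?_
              gcongr
          _ = _ := by ring
      refine (H n c x d _ (by omega) hd hd1 hx hsep hsmall p hp).trans ?_
      have : C / d ^ N * ((1 + 2 ^ q * T ^ q) * (1 / d ^ q) * B)
        = 1 * ((C * (1 + 2 ^ q * T ^ q)) * ((1 / d ^ N) * (1 / d ^ q)) * B) := by ring
      rw [this, mul_assoc (2 ^ q), mul_assoc (2 ^ q)]
      refine mul_le_mul_of_nonneg_right (one_le_pow₀ (by norm_num)) ?_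
      positivity
    · refine hcq'.trans ?_
      gcongr ?_ * B
      rw [mul_assoc (2 ^ p)]
      gcongr
      rw [← mul_assoc]
      refine le_mul_of_one_le_left (by positivity) ?_
      exact one_le_mul_of_one_le_of_one_le (one_le_mul_of_one_le_of_one_le hC hc1) hdN

/-- Sublevel estimate for a polynomial of degree `< q` plus a tail whose `n`-th derivative is
bounded below. -/
lemma exists_sublevel_bound (T : ℝ) (hT : 1 ≤ T) (q n : ℕ) (hqn : q ≤ n) (K : ℝ) (hK : 0 ≤ K) :
    ∃ (C : ℝ) (N : ℕ), 1 ≤ C ∧ ∀ (c : ℕ → ℝ) (R : ℕ → ℝ → ℝ) (b d τ : ℝ), 0 < d → d ≤ 1 →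
      (∀ i < n, ∀ t ∈ Set.Icc (-T) T, HasDerivAt (R i) (R (i + 1) t) t) →
      (∀ t ∈ Set.Icc (-T) T, b ≤ |R n t|) → (∀ t ∈ Set.Icc (-T) T, |R 0 t| ≤ K * b) →
      ENNReal.ofReal (2 * 2 ^ n * d) <
        volume {t | t ∈ Set.Icc (-T) T ∧ |powSumDeriv c q 0 t + R 0 t| ≤ τ} →
      ∑ p ∈ Finset.range q, |c p| + b ≤ C / d ^ N * τ := by
  obtain ⟨C₀, N₀, hC₀, H⟩ := exists_coeff_bound_of_separated T hT q
  refine ⟨q * (C₀ * (1 + K * 2 ^ n)) + 2 ^ n, N₀ + n, ?_, ?_⟩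
  · have h1 : (1 : ℝ) ≤ 2 ^ n := one_le_pow₀ (by norm_num)
    have h2 : (0 : ℝ) ≤ q * (C₀ * (1 + K * 2 ^ n)) := by positivity
    linarith
  intro c R b d τ hd hd1 hR hb hRK hvol
  obtain ⟨x, hxS, hsep⟩ := exists_separated_of_volume hd (2 ^ n)
    {t | t ∈ Set.Icc (-T) T ∧ |powSumDeriv c q 0 t + R 0 t| ≤ τ}
    (bddBelow_Icc.mono fun t ht => ht.1) (by push_cast; exact hvol)
  have hx : ∀ i < 2 ^ n, x i ∈ Set.Icc (-T) T := fun i hi => (hxS i (by omega)).1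
  have hxτ : ∀ i < 2 ^ n, |powSumDeriv c q 0 (x i) + R 0 (x i)| ≤ τ :=
    fun i hi => (hxS i (by omega)).2
  have hτ : 0 ≤ τ := (abs_nonneg _).trans (hxτ 0 (by positivity))
  obtain ⟨ξ, hξ, hξb⟩ := exists_abs_deriv_le_of_separated hd n
    (fun i t => powSumDeriv c q i t + R i t) x τ
    (fun i hi t ht => (hasDerivAt_powSumDeriv c q i t).add (hR i hi t ht)) hx
    (fun i hi => hsep i (by omega)) hxτ
  simp only [powSumDeriv_of_le c hqn, zero_add] at hξb
  have hbτ : b ≤ 2 ^ n * (1 / d ^ n) * τ := by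
    refine (hb ξ hξ).trans (hξb.trans_eq ?_)
    rw [div_pow]; ring
  have hdn : 1 ≤ 1 / d ^ n := by
    rw [le_div_iff₀ (by positivity), one_mul]
    exact pow_le_one₀ hd.le hd1
  have hdN : 1 ≤ 1 / d ^ N₀ := by
    rw [le_div_iff₀ (by positivity), one_mul]
    exact pow_le_one₀ hd.le hd1
  have hsmall : ∀ i < 2 ^ n, |powSumDeriv c q 0 (x i)| ≤ (1 + K * 2 ^ n) * (1 / d ^ n) * τ := by
    intro i hi
    have h1 : powSumDeriv c q 0 (x i)
        = (powSumDeriv c q 0 (x i) + R 0 (x i)) - R 0 (x i) := by ring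
    rw [h1]
    refine (abs_sub _ _).trans ?_
    calc _ ≤ (1 / d ^ n) * τ + K * (2 ^ n * (1 / d ^ n) * τ) := by
          refine add_le_add ((hxτ i hi).trans (le_mul_of_one_le_left hτ hdn))
            ((hRK _ (hx i hi)).trans ?_)
          gcongr
      _ = _ := by ring
  have hcoef := H n c x d _ hqn hd hd1 (fun i hi => abs_le.2 (hx i hi))
    (fun i hi => hsep i (by omega)) hsmall
  have hsum : ∑ p ∈ Finset.range q, |c p|
      ≤ q * (C₀ / d ^ N₀ * ((1 + K * 2 ^ n) * (1 / d ^ n) * τ)) := by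
    refine (Finset.sum_le_card_nsmul _ _ _ fun p hp => hcoef p (Finset.mem_range.1 hp)).trans_eq ?_
    simp
  have hfin : (q * (C₀ * (1 + K * 2 ^ n)) + 2 ^ n) / d ^ (N₀ + n) * τ
      = q * (C₀ / d ^ N₀ * ((1 + K * 2 ^ n) * (1 / d ^ n) * τ))
        + (1 / d ^ N₀) * (2 ^ n * (1 / d ^ n) * τ) := by
    rw [pow_add]; field_simp
  rw [hfin]
  exact add_le_add hsum (hbτ.trans (le_mul_of_one_le_left (by positivity) hdN))

/-- Integration by parts against the regularisation `F' / (F' ^ 2 + η ^ 2)` of `1 / F'`. -/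
lemma norm_integral_exp_mul_le_s19 {T : ℝ} (hT : 0 ≤ T) {F F1 F2 Φ Φ1 : ℝ → ℝ} {lam Q η : ℝ}
    (hF : ∀ t ∈ Set.Icc (-T) T, HasDerivAt F (F1 t) t)
    (hF1 : ∀ t ∈ Set.Icc (-T) T, HasDerivAt F1 (F2 t) t)
    (hF2 : ContinuousOn F2 (Set.Icc (-T) T))
    (hQ : ∀ t ∈ Set.Icc (-T) T, |F2 t| ≤ Q)
    (hΦ : ∀ t, HasDerivAt Φ (Φ1 t) t) (hΦ1 : Continuous Φ1)
    (hb : ∀ t, |Φ t| ≤ 1) (hb1 : ∀ t, |Φ1 t| ≤ 1) (hΦT : Φ T = 0) (hΦT' : Φ (-T) = 0)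
    (hlam : lam ≠ 0) (hη : 0 < η) :
    ‖∫ t in (-T)..T, Complex.exp (2 * (π : ℂ) * Complex.I * ((lam * F t : ℝ) : ℂ)) * (Φ t : ℂ)‖
      ≤ 2 * T * ((1 / η + Q / η ^ 2) / |lam|) +
        ∫ t in (-T)..T, η ^ 2 / (F1 t ^ 2 + η ^ 2) := by
  have hTT : -T ≤ T := by linarith
  have hpos : ∀ t, 0 < F1 t ^ 2 + η ^ 2 := fun t => by positivity
  set E : ℝ → ℂ := fun t => Complex.exp (2 * (π : ℂ) * Complex.I * ((lam * F t : ℝ) : ℂ)) with hE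
  have hEnorm : ∀ t, ‖E t‖ = 1 := by
    intro t
    have : 2 * (π : ℂ) * Complex.I * ((lam * F t : ℝ) : ℂ)
      = ((2 * π * (lam * F t) : ℝ) : ℂ) * Complex.I := by push_cast; ring
    simp only [hE]
    rw [this, Complex.norm_exp_ofReal_mul_I]
  have hEd : ∀ t ∈ Set.Icc (-T) T,
      HasDerivAt E (E t * (2 * π * Complex.I * ((lam * F1 t : ℝ) : ℂ))) t := by
    intro t ht
    exact ((((hF t ht).const_mul lam).ofReal_comp).const_mul _).cexp
  set W : ℝ → ℝ := fun t => Φ t * (F1 t / (F1 t ^ 2 + η ^ 2)) with hW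
  set W1 : ℝ → ℝ := fun t => Φ1 t * (F1 t / (F1 t ^ 2 + η ^ 2)) +
    Φ t * ((F2 t * (F1 t ^ 2 + η ^ 2) - F1 t * (2 * F1 t * F2 t)) / (F1 t ^ 2 + η ^ 2) ^ 2) with hW1
  have hWd : ∀ t ∈ Set.Icc (-T) T, HasDerivAt W (W1 t) t := by
    intro t ht
    refine (hΦ t).mul ((hF1 t ht).div ?_ (hpos t).ne')
    simpa using ((hF1 t ht).pow 2).add_const (η ^ 2)
  have hFc : ContinuousOn F1 (Set.Icc (-T) T) :=
    fun t ht => (hF1 t ht).continuousAt.continuousWithinAt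
  have hEc : ContinuousOn E (Set.Icc (-T) T) :=
    fun t ht => (hEd t ht).continuousAt.continuousWithinAt
  have hΦc : Continuous Φ := continuous_iff_continuousAt.2 fun t => (hΦ t).continuousAt
  have hWc : ContinuousOn W (Set.Icc (-T) T) :=
    fun t ht => (hWd t ht).continuousAt.continuousWithinAt
  have hden : ContinuousOn (fun t => F1 t ^ 2 + η ^ 2) (Set.Icc (-T) T) := by fun_prop
  have hW1c : ContinuousOn W1 (Set.Icc (-T) T) := by
    refine ContinuousOn.add (hΦ1.continuousOn.mul (hFc.div hden fun t _ => (hpos t).ne'))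
      (hΦc.continuousOn.mul (ContinuousOn.div (by fun_prop) (by fun_prop) fun t _ => ?_))
    exact (pow_pos (hpos t) 2).ne'
  have hW1b : ∀ t ∈ Set.Icc (-T) T, |W1 t| ≤ 1 / η + Q / η ^ 2 := by
    intro t ht
    refine (abs_add_le _ _).trans (add_le_add ?_ ?_)
    · rw [abs_mul, abs_div, abs_of_pos (hpos t)]
      refine (mul_le_of_le_one_left (by positivity) (hb1 t)).trans ?_
      rw [div_le_div_iff₀ (hpos t) hη]
      nlinarith [sq_nonneg (|F1 t| - η), sq_abs (F1 t), sq_nonneg (F1 t)]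
    · rw [abs_mul, abs_div, abs_of_pos (pow_pos (hpos t) 2)]
      refine (mul_le_of_le_one_left (by positivity) (hb t)).trans ?_
      have h1 : F2 t * (F1 t ^ 2 + η ^ 2) - F1 t * (2 * F1 t * F2 t)
        = F2 t * (η ^ 2 - F1 t ^ 2) := by ring
      have h2 : |η ^ 2 - F1 t ^ 2| ≤ F1 t ^ 2 + η ^ 2 := by
        rw [abs_le]; constructor <;> nlinarith [sq_nonneg (F1 t), sq_nonneg η]
      have hQ0 : 0 ≤ Q := (abs_nonneg _).trans (hQ t ht)
      rw [h1, abs_mul]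
      calc |F2 t| * |η ^ 2 - F1 t ^ 2| / (F1 t ^ 2 + η ^ 2) ^ 2
          ≤ Q * (F1 t ^ 2 + η ^ 2) / (F1 t ^ 2 + η ^ 2) ^ 2 := by
            gcongr
            exact hQ t ht
        _ = Q / (F1 t ^ 2 + η ^ 2) := by
            have := (hpos t).ne'
            field_simp
        _ ≤ Q / η ^ 2 := by
            gcongr
            nlinarith [sq_nonneg (F1 t)]
  set κ : ℂ := 2 * π * Complex.I * lam with hκ
  have hκn : ‖κ‖ = 2 * π * |lam| := by
    simp [hκ, abs_of_pos Real.pi_pos]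
  have hκ0 : κ ≠ 0 := by
    rw [← norm_pos_iff, hκn]
    have := Real.pi_pos
    positivity
  set U : ℝ → ℂ := fun t => E t * (F1 t * W t : ℝ) with hU
  set V : ℝ → ℂ := fun t => E t * (W1 t : ℂ) with hV
  set Z : ℝ → ℂ := fun t => E t * ((Φ t * (η ^ 2 / (F1 t ^ 2 + η ^ 2)) : ℝ) : ℂ) with hZ
  have hofReal : ∀ {f : ℝ → ℝ}, ContinuousOn f (Set.Icc (-T) T) →
      ContinuousOn (fun t => (f t : ℂ)) (Set.Icc (-T) T) :=
    fun hf => Complex.continuous_ofReal.comp_continuousOn hf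
  have hUi : IntervalIntegrable U volume (-T) T :=
    (hEc.mul (hofReal (hFc.mul hWc))).intervalIntegrable_of_Icc hTT
  have hVi : IntervalIntegrable V volume (-T) T :=
    (hEc.mul (hofReal hW1c)).intervalIntegrable_of_Icc hTT
  have hGc : ContinuousOn (fun t => η ^ 2 / (F1 t ^ 2 + η ^ 2)) (Set.Icc (-T) T) :=
    continuousOn_const.div hden fun t _ => (hpos t).ne'
  have hZi : IntervalIntegrable Z volume (-T) T :=
    (hEc.mul (hofReal (hΦc.continuousOn.mul hGc))).intervalIntegrable_of_Icc hTT
  have hparts : κ * (∫ t in (-T)..T, U t) + ∫ t in (-T)..T, V t = 0 := by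
    rw [← intervalIntegral.integral_const_mul, ← intervalIntegral.integral_add
      (hUi.const_mul κ) hVi]
    rw [intervalIntegral.integral_eq_sub_of_hasDerivAt (f := fun t => E t * (W t : ℂ))]
    · simp [hW, hΦT, hΦT']
    · intro t ht
      rw [Set.uIcc_of_le hTT] at ht
      refine ((hEd t ht).mul (hWd t ht).ofReal_comp).congr_deriv ?_
      simp only [hU, hV, hκ]
      push_cast
      ring
    · exact (hUi.const_mul κ).add hVi
  have hsplit : (∫ t in (-T)..T, E t * (Φ t : ℂ))
      = (∫ t in (-T)..T, U t) + ∫ t in (-T)..T, Z t := by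
    rw [← intervalIntegral.integral_add hUi hZi]
    congr 1
    funext t
    simp only [hU, hZ, hW]
    rw [← mul_add, ← Complex.ofReal_add]
    congr 2
    have := (hpos t).ne'
    field_simp
  have hUb : ‖∫ t in (-T)..T, U t‖ ≤ 2 * T * ((1 / η + Q / η ^ 2) / |lam|) := by
    have h1 : (∫ t in (-T)..T, U t) = -(∫ t in (-T)..T, V t) / κ := by
      rw [eq_div_iff hκ0]; linear_combination hparts
    have h2 : ‖∫ t in (-T)..T, V t‖ ≤ (1 / η + Q / η ^ 2) * |T - -T| := by
      refine intervalIntegral.norm_integral_le_of_norm_le_const fun t ht => ?_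
      rw [Set.uIoc_of_le hTT] at ht
      simp only [hV]
      rw [norm_mul, hEnorm, one_mul, Complex.norm_real]
      exact hW1b t (Set.Ioc_subset_Icc_self ht)
    have h3 : |T - -T| = 2 * T := by rw [abs_of_nonneg (by linarith)]; ring
    rw [h1, norm_div, norm_neg, hκn]
    rw [h3] at h2
    have hl : 0 < |lam| := abs_pos.2 hlam
    calc _ ≤ (1 / η + Q / η ^ 2) * (2 * T) / |lam| := by
          refine div_le_div₀ ((norm_nonneg _).trans h2) h2 hl ?_
          nlinarith [Real.pi_gt_three]
      _ = _ := by ring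
  have hZb : ‖∫ t in (-T)..T, Z t‖ ≤ ∫ t in (-T)..T, η ^ 2 / (F1 t ^ 2 + η ^ 2) := by
    refine intervalIntegral.norm_integral_le_of_norm_le hTT (ae_of_all _ fun t _ => ?_)
      (hGc.intervalIntegrable_of_Icc hTT)
    simp only [hZ]
    rw [norm_mul, hEnorm, one_mul, Complex.norm_real, Real.norm_eq_abs, abs_mul]
    rw [abs_of_pos (div_pos (pow_pos hη 2) (hpos t))]
    exact mul_le_of_le_one_left (div_pos (pow_pos hη 2) (hpos t)).le (hb t)
  rw [hsplit]
  exact (norm_add_le _ _).trans (add_le_add hUb hZb)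

lemma integral_regularized_le {T : ℝ} (hT : 0 ≤ T) {f : ℝ → ℝ}
    (hf : ContinuousOn f (Set.Icc (-T) T)) {η τ v : ℝ} (hη : 0 < η) (hτ : 0 < τ) (hv : 0 ≤ v)
    (hvol : volume {t | t ∈ Set.Icc (-T) T ∧ |f t| ≤ τ} ≤ ENNReal.ofReal v) :
    ∫ t in (-T)..T, η ^ 2 / (f t ^ 2 + η ^ 2) ≤ v + 2 * T * (η / τ) ^ 2 := by
  have hTT : -T ≤ T := by linarith
  set S := {t | t ∈ Set.Icc (-T) T ∧ |f t| ≤ τ} with hS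
  have hSm : MeasurableSet S := by
    have : IsClosed S := hf.abs.preimage_isClosed_of_isClosed isClosed_Icc isClosed_Iic
    exact this.measurableSet
  have hSfin : volume S ≠ ⊤ := ne_top_of_le_ne_top ENNReal.ofReal_ne_top hvol
  have hSi : Integrable (S.indicator fun _ => (1 : ℝ)) volume :=
    (integrable_indicator_iff hSm).2 (integrableOn_const hSfin)
  have hGc : ContinuousOn (fun t => η ^ 2 / (f t ^ 2 + η ^ 2)) (Set.Icc (-T) T) :=
    continuousOn_const.div (by fun_prop) fun t _ => by positivity
  have hpt : ∀ t ∈ Set.Icc (-T) T,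
      η ^ 2 / (f t ^ 2 + η ^ 2) ≤ S.indicator (fun _ => (1 : ℝ)) t + (η / τ) ^ 2 := by
    intro t ht
    by_cases h : |f t| ≤ τ
    · have h1 : t ∈ S := ⟨ht, h⟩
      have h2 : η ^ 2 / (f t ^ 2 + η ^ 2) ≤ 1 := by
        rw [div_le_one (by positivity)]
        nlinarith [sq_nonneg (f t)]
      rw [Set.indicator_of_mem h1]
      have : 0 ≤ (η / τ) ^ 2 := by positivity
      linarith
    · have h1 : t ∉ S := fun h' => h h'.2
      rw [Set.indicator_of_notMem h1, zero_add, div_pow]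
      have h2 : τ ^ 2 ≤ f t ^ 2 := by
        rw [← sq_abs (f t)]
        exact pow_le_pow_left₀ hτ.le (not_le.1 h).le 2
      gcongr
      nlinarith [sq_nonneg η]
  have hII : IntervalIntegrable (S.indicator fun _ => (1 : ℝ)) volume (-T) T :=
    hSi.intervalIntegrable
  refine (intervalIntegral.integral_mono_on hTT (hGc.intervalIntegrable_of_Icc hTT)
    (hII.add intervalIntegrable_const) hpt).trans ?_
  rw [intervalIntegral.integral_add hII intervalIntegrable_const, intervalIntegral.integral_const,
    smul_eq_mul]
  refine add_le_add ?_ (le_of_eq (by ring))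
  rw [intervalIntegral.integral_of_le hTT]
  refine (setIntegral_le_integral hSi (ae_of_all _ fun t =>
    Set.indicator_nonneg (fun _ _ => zero_le_one) t)).trans ?_
  rw [integral_indicator hSm, setIntegral_const, smul_eq_mul, mul_one]
  exact ENNReal.toReal_le_of_le_ofReal hv hvol

lemma exists_decay_powSum_add_tail {T : ℝ} (hT : 1 ≤ T) (q n : ℕ) (hqn : q ≤ n) (K : ℝ)
    (hK : 0 ≤ K) : ∃ ε C : ℝ, 0 < ε ∧ 0 < C ∧
      ∀ (F Φ Φ1 : ℝ → ℝ) (c : ℕ → ℝ) (R : ℕ → ℝ → ℝ) (b lam : ℝ), 0 ≤ b →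
      (∀ t ∈ Set.Icc (-T) T, HasDerivAt F (powSumDeriv c q 0 t + R 0 t) t) →
      (∀ i, ∀ t ∈ Set.Icc (-T) T, HasDerivAt (R i) (R (i + 1) t) t) →
      (∀ t ∈ Set.Icc (-T) T, b ≤ |R n t|) →
      (∀ t ∈ Set.Icc (-T) T, |R 0 t| ≤ K * b) →
      (∀ t ∈ Set.Icc (-T) T, |R 1 t| ≤ K * b) →
      (∀ t, HasDerivAt Φ (Φ1 t) t) → Continuous Φ1 →
      (∀ t, |Φ t| ≤ 1) → (∀ t, |Φ1 t| ≤ 1) → Φ T = 0 → Φ (-T) = 0 →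
      ‖∫ t in (-T)..T,
          Complex.exp (2 * (π : ℂ) * Complex.I * ((lam * F t : ℝ) : ℂ)) * (Φ t : ℂ)‖
        * (|lam| * (∑ p ∈ Finset.range q, |c p| + b)) ^ ε ≤ C := by
  obtain ⟨C₀, N, hC₀, H⟩ := exists_sublevel_bound T hT q n hqn K hK
  have hT0 : 0 < T := by linarith
  set K₁ : ℝ := q ^ 1 * T ^ q + K with hK₁
  have hK₁0 : 0 ≤ K₁ := by positivity
  set ε : ℝ := 1 / ((2 * N + 3 : ℕ) : ℝ) with hε
  have hε0 : 0 < ε := by positivity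
  set C' : ℝ := 2 * T * (2 * C₀ + 4 * C₀ ^ 2 * K₁) + 2 * 2 ^ n + 2 * T with hC'
  have hC'0 : 2 * T ≤ C' := by
    have : 0 ≤ 2 * T * (2 * C₀ + 4 * C₀ ^ 2 * K₁) + 2 * 2 ^ n := by positivity
    linarith
  refine ⟨ε, C', hε0, by linarith, ?_⟩
  intro F Φ Φ1 c R b lam hb hF hR hRn hR0 hR1 hΦ hΦ1 hΦb hΦ1b hΦT hΦT'
  set A := ∑ p ∈ Finset.range q, |c p| + b with hA
  have hA0 : 0 ≤ A := add_nonneg (Finset.sum_nonneg fun _ _ => abs_nonneg _) hb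
  set L := |lam| * A with hL
  have hL0 : 0 ≤ L := by positivity
  rcases le_or_gt L 1 with hL1 | hL1
  · have htriv : ‖∫ t in (-T)..T,
          Complex.exp (2 * (π : ℂ) * Complex.I * ((lam * F t : ℝ) : ℂ)) * (Φ t : ℂ)‖
        ≤ 1 * |T - -T| := by
      refine intervalIntegral.norm_integral_le_of_norm_le_const fun t _ => ?_
      have : 2 * (π : ℂ) * Complex.I * ((lam * F t : ℝ) : ℂ)
        = ((2 * π * (lam * F t) : ℝ) : ℂ) * Complex.I := by push_cast; ring
      rw [this, norm_mul, Complex.norm_exp_ofReal_mul_I, one_mul, Complex.norm_real]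
      exact hΦb t
    rw [abs_of_nonneg (by linarith)] at htriv
    refine le_trans (mul_le_of_le_one_right (norm_nonneg _)
      (Real.rpow_le_one hL0 hL1 hε0.le)) ?_
    linarith
  have hlam : lam ≠ 0 := by
    rintro rfl
    simp [hL] at hL1
    linarith
  have hl : 0 < |lam| := abs_pos.2 hlam
  have hApos : 0 < A := by
    by_contra h
    have : A = 0 := le_antisymm (not_lt.1 h) hA0
    rw [hL, this, mul_zero] at hL1
    linarith
  set w : ℝ := L ^ (-ε) with hw
  have hw0 : 0 < w := Real.rpow_pos_of_pos (by linarith) _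
  have hw1 : w ≤ 1 := Real.rpow_le_one_of_one_le_of_nonpos hL1.le (by linarith)
  have hwL : w * L ^ ε = 1 := by
    rw [hw, ← Real.rpow_add (by linarith), neg_add_cancel, Real.rpow_zero]
  have hLw : L * w ^ (2 * N + 3) = 1 := by
    rw [hw, ← Real.rpow_natCast, ← Real.rpow_mul hL0, hε]
    have h1 : -(1 / ((2 * N + 3 : ℕ) : ℝ)) * ((2 * N + 3 : ℕ) : ℝ) = -1 := by
      have : ((2 * N + 3 : ℕ) : ℝ) ≠ 0 := by positivity
      field_simp
    rw [h1, Real.rpow_neg_one, mul_inv_cancel₀ (by linarith)]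
  set τ : ℝ := A * w ^ N / (2 * C₀) with hτ
  have hτ0 : 0 < τ := by positivity
  set η : ℝ := τ * w with hη
  have hη0 : 0 < η := by positivity
  set f : ℝ → ℝ := fun t => powSumDeriv c q 0 t + R 0 t with hf
  have hfd : ∀ t ∈ Set.Icc (-T) T, HasDerivAt f (powSumDeriv c q 1 t + R 1 t) t :=
    fun t ht => (hasDerivAt_powSumDeriv c q 0 t).add (hR 0 t ht)
  have hvol : volume {t | t ∈ Set.Icc (-T) T ∧ |f t| ≤ τ}
      ≤ ENNReal.ofReal (2 * 2 ^ n * w) := by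
    by_contra! h
    have h1 := H c R b w τ hw0 hw1 (fun i _ => hR i) hRn hR0 h
    have h2 : C₀ / w ^ N * τ = A / 2 := by
      rw [hτ]; field_simp
    rw [h2, ← hA] at h1
    linarith
  have hF2b : ∀ t ∈ Set.Icc (-T) T, |powSumDeriv c q 1 t + R 1 t| ≤ K₁ * A := by
    intro t ht
    refine (abs_add_le _ _).trans ((add_le_add (abs_powSumDeriv_le c q 1 hT (abs_le.2 ht))
      (hR1 t ht)).trans ?_)
    have h1 : 0 ≤ ∑ p ∈ Finset.range q, |c p| := Finset.sum_nonneg fun _ _ => abs_nonneg _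
    have h2 : (0 : ℝ) ≤ q ^ 1 * T ^ q := by positivity
    rw [hK₁, hA]
    nlinarith [mul_nonneg h2 hb, mul_nonneg hK h1]
  have hmain := norm_integral_exp_mul_le_s19 hT0.le hF hfd
    (fun t ht => ((hasDerivAt_powSumDeriv c q 1 t).add
      (hR 1 t ht)).continuousAt.continuousWithinAt) hF2b hΦ hΦ1 hΦb hΦ1b hΦT hΦT' hlam hη0
  have hreg := integral_regularized_le hT0.le
    (fun t ht => (hfd t ht).continuousAt.continuousWithinAt) hη0 hτ0
    (by positivity : 0 ≤ 2 * 2 ^ n * w) hvol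
  have hητ : η / τ = w := by rw [hη]; field_simp
  rw [hητ] at hreg
  have h1 : 1 / η / |lam| = 2 * C₀ * w ^ (N + 2) := by
    have : 1 / η / |lam| = 2 * C₀ * w ^ (N + 2) / (L * w ^ (2 * N + 3)) := by
      rw [hη, hτ, hL]
      field_simp
      ring
    rw [this, hLw, div_one]
  have h2 : K₁ * A / η ^ 2 / |lam| = 4 * C₀ ^ 2 * K₁ * w := by
    have : K₁ * A / η ^ 2 / |lam| = 4 * C₀ ^ 2 * K₁ * w / (L * w ^ (2 * N + 3)) := by
      rw [hη, hτ, hL]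
      field_simp
      ring
    rw [this, hLw, div_one]
  have hpw : w ^ (N + 2) ≤ w := pow_le_of_le_one hw0.le hw1 (by omega)
  have hpw2 : w ^ 2 ≤ w := pow_le_of_le_one hw0.le hw1 (by omega)
  have hbound : ‖∫ t in (-T)..T,
          Complex.exp (2 * (π : ℂ) * Complex.I * ((lam * F t : ℝ) : ℂ)) * (Φ t : ℂ)‖
      ≤ C' * w := by
    refine hmain.trans ((add_le_add_right hreg _).trans ?_)
    rw [add_div, h1, h2]
    calc _ ≤ 2 * T * (2 * C₀ * w + 4 * C₀ ^ 2 * K₁ * w) + (2 * 2 ^ n * w + 2 * T * w) := by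
          gcongr
      _ = C' * w := by rw [hC']; ring
  calc _ ≤ C' * w * L ^ ε := by gcongr
    _ = C' := by rw [mul_assoc, hwL, mul_one]

/-- Local bounds for an analytic function vanishing to order at least `n`. -/
lemma exists_tail_bounds {ρ : ℝ → ℝ} (hρ : AnalyticAt ℝ ρ 0) (n : ℕ)
    (h0 : ∀ i < n, iteratedDeriv i ρ 0 = 0) :
    ∃ (M : ℕ) (b r : ℝ), n ≤ M ∧ 0 ≤ b ∧ 0 < r ∧ AnalyticOnNhd ℝ ρ (Metric.ball 0 r) ∧
      (∀ s ∈ Metric.ball (0 : ℝ) r, b ≤ |iteratedDeriv M ρ s|) ∧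
      ∀ i ≤ M, ∀ s ∈ Metric.ball (0 : ℝ) r, |iteratedDeriv i ρ s| ≤ 4 * b * |s| ^ (M - i) := by
  obtain ⟨r₀, hr₀, hball⟩ := Metric.eventually_nhds_iff_ball.1 hρ.eventually_analyticAt
  rcases eq_or_ne (analyticOrderAt ρ 0) ⊤ with htop | hfin
  · obtain ⟨r₁, hr₁, hz⟩ := Metric.eventually_nhds_iff_ball.1 (analyticOrderAt_eq_top.1 htop)
    have hD : ∀ i, ∀ s ∈ Metric.ball (0 : ℝ) r₁, iteratedDeriv i ρ s = 0 := by
      intro i s hs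
      have : ρ =ᶠ[nhds s] fun _ => 0 := by
        filter_upwards [Metric.isOpen_ball.mem_nhds hs] with y hy using hz y hy
      rw [this.iteratedDeriv_eq]
      simp
    refine ⟨n, 0, min r₀ r₁, le_rfl, le_rfl, lt_min hr₀ hr₁,
      fun s hs => hball s (Metric.ball_subset_ball (min_le_left _ _) hs),
      fun s _ => abs_nonneg _, fun i _ s hs => ?_⟩
    rw [hD i s (Metric.ball_subset_ball (min_le_right _ _) hs)]
    simp
  · obtain ⟨M, hM⟩ := ENat.ne_top_iff_exists.1 hfin
    obtain ⟨hlow, hne⟩ := (analyticOrderAt_eq_nat_iff_iteratedDeriv_eq_zero hρ).1 hM.symm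
    have hnM : n ≤ M := by
      by_contra! h
      exact hne (h0 M h)
    have hDM : ContinuousAt (fun s => |iteratedDeriv M ρ s|) 0 := by
      rw [iteratedDeriv_eq_iterate]
      exact (hρ.iterated_deriv M).continuousAt.abs
    have hpos : 0 < |iteratedDeriv M ρ 0| := abs_pos.2 hne
    have hev := (hDM.eventually (lt_mem_nhds (show |iteratedDeriv M ρ 0| / 2 < _ by linarith))).and
      (hDM.eventually (gt_mem_nhds (show _ < 2 * |iteratedDeriv M ρ 0| by linarith)))
    obtain ⟨r₁, hr₁, hz⟩ := Metric.eventually_nhds_iff_ball.1 hev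
    have hsub₀ : Metric.ball (0 : ℝ) (min r₀ r₁) ⊆ Metric.ball 0 r₀ :=
      Metric.ball_subset_ball (min_le_left _ _)
    have hsub₁ : Metric.ball (0 : ℝ) (min r₀ r₁) ⊆ Metric.ball 0 r₁ :=
      Metric.ball_subset_ball (min_le_right _ _)
    refine ⟨M, |iteratedDeriv M ρ 0| / 2, min r₀ r₁, hnM, by positivity, lt_min hr₀ hr₁,
      fun s hs => hball s (hsub₀ hs), fun s hs => (hz s (hsub₁ hs)).1.le, ?_⟩
    suffices ∀ k ≤ M, ∀ s ∈ Metric.ball (0 : ℝ) (min r₀ r₁),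
        |iteratedDeriv (M - k) ρ s| ≤ 4 * (|iteratedDeriv M ρ 0| / 2) * |s| ^ k by
      intro i hi s hs
      simpa [Nat.sub_sub_self hi] using this (M - i) (by omega) s hs
    intro k
    induction k with
    | zero =>
      intro _ s hs
      have := (hz s (hsub₁ hs)).2
      simp only [Nat.sub_zero, pow_zero, mul_one]
      linarith
    | succ k ih =>
      intro hk s hs
      have hseg : ∀ y ∈ Metric.closedBall (0 : ℝ) |s|, y ∈ Metric.ball (0 : ℝ) (min r₀ r₁) := by
        intro y hy
        simp only [Metric.mem_closedBall, Metric.mem_ball, dist_zero_right, Real.norm_eq_abs]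
          at hy hs ⊢
        exact hy.trans_lt hs
      have hder : ∀ y ∈ Metric.closedBall (0 : ℝ) |s|,
          HasDerivWithinAt (iteratedDeriv (M - (k + 1)) ρ) (iteratedDeriv (M - k) ρ y)
            (Metric.closedBall 0 |s|) y := by
        intro y hy
        have hd : DifferentiableAt ℝ (iteratedDeriv (M - (k + 1)) ρ) y := by
          rw [iteratedDeriv_eq_iterate]
          exact ((hball y (hsub₀ (hseg y hy))).iterated_deriv _).differentiableAt
        have := hd.hasDerivAt.hasDerivWithinAt (s := Metric.closedBall 0 |s|)
        rwa [← iteratedDeriv_succ, show M - (k + 1) + 1 = M - k by omega] at this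
      have hbd : ∀ y ∈ Metric.closedBall (0 : ℝ) |s|, ‖iteratedDeriv (M - k) ρ y‖
          ≤ 4 * (|iteratedDeriv M ρ 0| / 2) * |s| ^ k := by
        intro y hy
        refine (ih (by omega) y (hseg y hy)).trans ?_
        rw [mem_closedBall_zero_iff, Real.norm_eq_abs] at hy
        gcongr
      have := (convex_closedBall (0 : ℝ) |s|).norm_image_sub_le_of_norm_hasDerivWithin_le hder hbd
        (Metric.mem_closedBall_self (abs_nonneg s)) (show s ∈ Metric.closedBall (0 : ℝ) |s| by simp)
      rw [hlow _ (by omega), sub_zero, sub_zero, Real.norm_eq_abs, Real.norm_eq_abs] at this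
      rwa [pow_succ, ← mul_assoc]

/-- Splitting off the Taylor polynomial of degree `< n`. -/
lemma exists_polynomial_add_tail {φ : ℝ → ℝ} (hφ : AnalyticAt ℝ φ 0) (n : ℕ) :
    ∃ (a : ℕ → ℝ) (ρ : ℝ → ℝ), AnalyticAt ℝ ρ 0 ∧ (∀ i < n, iteratedDeriv i ρ 0 = 0) ∧
      ∀ s, φ s = ∑ p ∈ Finset.range n, a p * s ^ p + ρ s := by
  refine ⟨fun p => iteratedDeriv p φ 0 / p.factorial,
    fun s => φ s - ∑ p ∈ Finset.range n, iteratedDeriv p φ 0 / p.factorial * s ^ p,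
    by fun_prop, fun i hi => ?_, fun s => by ring⟩
  rw [iteratedDeriv_fun_sub hφ.contDiffAt (by fun_prop),
    iteratedDeriv_fun_sum fun p _ => by fun_prop]
  simp_rw [iteratedDeriv_const_mul_field, iteratedDeriv_fun_pow_zero]
  rw [Finset.sum_eq_single i]
  · have : (i.factorial : ℝ) ≠ 0 := by positivity
    simp [this]
  · intro p _ hp
    simp [hp.symm]
  · intro h
    exact absurd (Finset.mem_range.2 hi) h

lemma exists_pow_le_abs_of_iteratedDeriv_ne_zero {f : ℝ → ℝ} (hf : AnalyticAt ℝ f 0) {ℓ : ℕ}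
    (h : iteratedDeriv ℓ f 0 ≠ 0) :
    ∃ c > 0, ∃ r > 0, ∀ u : ℝ, |u| < r → c * |u| ^ ℓ ≤ |f u| := by
  have hnot : ¬ ((ℓ + 1 : ℕ) : ℕ∞) ≤ analyticOrderAt f 0 := by
    rw [natCast_le_analyticOrderAt_iff_iteratedDeriv_eq_zero hf]
    exact fun h' => h (h' ℓ (by omega))
  have hfin : analyticOrderAt f 0 ≠ ⊤ := fun h' => hnot (by simp [h'])
  obtain ⟨m, hm⟩ := ENat.ne_top_iff_exists.1 hfin
  have hmℓ : m ≤ ℓ := by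
    rw [← hm, Nat.cast_le] at hnot
    omega
  obtain ⟨g, hg, hg0, hfg⟩ := hf.analyticOrderAt_eq_natCast.1 hm.symm
  have hpos : 0 < |g 0| := abs_pos.2 hg0
  have hev := hg.continuousAt.abs.eventually (lt_mem_nhds (show |g 0| / 2 < |g 0| by linarith))
  obtain ⟨r, hr, hz⟩ := Metric.eventually_nhds_iff_ball.1 (hfg.and hev)
  refine ⟨|g 0| / 2, by positivity, min r 1, lt_min hr one_pos, fun u hu => ?_⟩
  obtain ⟨h1, h2⟩ := hz u (by simpa using hu.trans_le (min_le_left _ _))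
  rw [h1, sub_zero, smul_eq_mul, abs_mul, abs_pow, mul_comm]
  have h3 : |u| ^ ℓ ≤ |u| ^ m :=
    pow_le_pow_of_le_one (abs_nonneg u) (hu.trans_le (min_le_right _ _)).le hmℓ
  gcongr

lemma integral_rescale_eq {a T : ℝ} (ha : 0 < a) {Φ : ℝ → ℝ} (g : ℝ → ℂ)
    (hsupp : ∀ t, Φ t ≠ 0 → t ∈ Set.Ioc (-T) T) :
    ∫ s : ℝ, g s * ((a * Φ (a * s) : ℝ) : ℂ)
      = ∫ t in (-T)..T, g (a⁻¹ * t) * (Φ t : ℂ) := by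
  have h1 : ∀ s : ℝ, g s * ((a * Φ (a * s) : ℝ) : ℂ)
      = (a : ℂ) * (fun t => g (a⁻¹ * t) * (Φ t : ℂ)) (a * s) := by
    intro s
    simp only [inv_mul_cancel_left₀ ha.ne']
    push_cast
    ring
  simp_rw [h1]
  rw [integral_const_mul, Measure.integral_comp_mul_left (fun t => g (a⁻¹ * t) * (Φ t : ℂ)) a,
    abs_of_pos (inv_pos.2 ha), Complex.real_smul, ← mul_assoc, ← Complex.ofReal_mul,
    mul_inv_cancel₀ ha.ne', Complex.ofReal_one, one_mul]
  refine (intervalIntegral.integral_eq_integral_of_support_subset fun t ht => hsupp t ?_).symm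
  intro h
  simp [h] at ht

/-- Let `p₀ ≥ 2`, let `φ, ψ₁, …, ψ_{p₀-1}` be real-analytic near `0` and
vanishing at `0`, and fix `p_r ∈ {1, …, p₀-1}` with `ψ_{p_r} ≢ 0` of vanishing order
`ℓ_r ≥ 1` at `0`.  Then there are `ε, C > 0` and positive integers `J, K₀` such that for all
`λ ∈ ℝ`, scales `j ≤ -J`, `k ≤ -K₀`, `|u| ∼ 2^k`, and unit-`C¹` bumps `Φ` supported in
`{1/2 ≤ |s| ≤ 2}`,
`|∫ e^{2πi λ(φ(s) + Σ_{p=1}^{p₀-1} ψ_p(u) s^p)} 2^{-j} Φ(2^{-j}s) ds|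
   ≤ C (|λ| 2^{ℓ_r k} 2^{p_r j})^{-ε}`
(stated multiplicatively so as to include `λ = 0`). -/
theorem oscillatory_decay_lower_coefficient
    (p₀ : ℕ) (hp₀ : 2 ≤ p₀) (φ : ℝ → ℝ) (ψ : ℕ → ℝ → ℝ)
    (hφ : AnalyticAt ℝ φ 0) (hφ0 : φ 0 = 0)
    (hψ : ∀ p : ℕ, 1 ≤ p → p < p₀ → AnalyticAt ℝ (ψ p) 0 ∧ ψ p 0 = 0)
    (pr : ℕ) (hpr1 : 1 ≤ pr) (hpr2 : pr < p₀)
    (ℓr : ℕ) (hℓr : 1 ≤ ℓr)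
    (hord1 : ∀ ℓ : ℕ, ℓ < ℓr → iteratedDeriv ℓ (ψ pr) 0 = 0)
    (hord2 : iteratedDeriv ℓr (ψ pr) 0 ≠ 0) :
    ∃ ε C : ℝ, 0 < ε ∧ 0 < C ∧ ∃ J K₀ : ℕ, 0 < J ∧ 0 < K₀ ∧
      ∀ lam : ℝ, ∀ j k : ℤ, j ≤ -(J : ℤ) → k ≤ -(K₀ : ℤ) →
      ∀ u : ℝ, (2 : ℝ) ^ (k - 1) ≤ |u| → |u| ≤ (2 : ℝ) ^ (k + 1) →
      ∀ Φ : ℝ → ℝ, ContDiff ℝ (⊤ : ℕ∞) Φ →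
        (∀ s : ℝ, Φ s ≠ 0 → 1 / 2 ≤ |s| ∧ |s| ≤ 2) →
        (∀ s : ℝ, |Φ s| ≤ 1 ∧ |deriv Φ s| ≤ 1) →
        ‖∫ s : ℝ, Complex.exp (2 * (π : ℂ) * Complex.I *
              ((lam * (φ s + ∑ p ∈ Finset.Ico 1 p₀, ψ p u * s ^ p) : ℝ) : ℂ)) *
            (((2 : ℝ) ^ (-j) * Φ ((2 : ℝ) ^ (-j) * s) : ℝ) : ℂ)‖
          * (|lam| * (2 : ℝ) ^ ((ℓr : ℤ) * k) * (2 : ℝ) ^ ((pr : ℤ) * j)) ^ ε ≤ C := by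
  obtain ⟨a, ρ, hρ, hρ0, hφeq⟩ := exists_polynomial_add_tail hφ p₀
  obtain ⟨M, b, r, hM, hb, hr, hana, hlow, hup⟩ := exists_tail_bounds hρ p₀ hρ0
  obtain ⟨q, rfl⟩ : ∃ q, p₀ = q + 1 := ⟨p₀ - 1, by omega⟩
  obtain ⟨n, rfl⟩ : ∃ n, M = n + 1 := ⟨M - 1, by omega⟩
  obtain ⟨ε, C, hε, hC, hdecay⟩ := exists_decay_powSum_add_tail (T := 3) (by norm_num) q n
    (by omega) (4 * 3 ^ n) (by positivity)
  obtain ⟨c₀, hc₀, r₁, hr₁, hψlow⟩ := exists_pow_le_abs_of_iteratedDeriv_ne_zero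
    (f := fun u => a pr + ψ pr u) (analyticAt_const.add (hψ pr hpr1 hpr2).1) (ℓ := ℓr)
    (by rwa [iteratedDeriv_const_add (by omega)])
  obtain ⟨J, hJ⟩ := exists_pow_lt_of_lt_one (show 0 < r / 3 by positivity)
    (show (2 : ℝ)⁻¹ < 1 by norm_num)
  obtain ⟨K₀, hK₀⟩ := exists_pow_lt_of_lt_one (show 0 < r₁ / 2 by positivity)
    (show (2 : ℝ)⁻¹ < 1 by norm_num)
  refine ⟨ε, C * (2 ^ ℓr / c₀) ^ ε, hε, by positivity, J + 1, K₀ + 1, by omega, by omega, ?_⟩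
  intro lam j k hj hk u hu1 hu2 Φ hΦ hsupp hΦb
  have hzpow : ∀ (m : ℤ) (N : ℕ), m ≤ -(N : ℤ) → (2 : ℝ) ^ m ≤ (2 : ℝ)⁻¹ ^ N := by
    intro m N h
    rw [inv_pow, ← zpow_natCast, ← zpow_neg]
    exact zpow_le_zpow_right₀ (by norm_num) h
  set σ : ℝ := (2 : ℝ) ^ j with hσ
  have hσ0 : 0 < σ := by positivity
  have hσr : 3 * σ < r := by
    have := hzpow j J (by push_cast at hj; omega)
    linarith
  have hu : |u| < r₁ := by
    have := hzpow k K₀ (by push_cast at hk; omega)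
    rw [zpow_add_one₀ (by norm_num)] at hu2
    linarith
  have hinv : (2 : ℝ) ^ (-j) = σ⁻¹ := by rw [zpow_neg]
  rw [hinv, integral_rescale_eq (T := 3) (inv_pos.2 hσ0)
    (fun s : ℝ => Complex.exp (2 * (π : ℂ) * Complex.I *
      ((lam * (φ s + ∑ p ∈ Finset.Ico 1 (q + 1), ψ p u * s ^ p) : ℝ) : ℂ)))
    (fun t ht => by
      have := abs_le.1 (hsupp t ht).2
      exact ⟨by linarith, by linarith⟩)]
  simp only [inv_inv]
  set c : ℕ → ℝ := fun p => (a (p + 1) + ψ (p + 1) u) * σ ^ (p + 1) * (p + 1) with hc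
  set R : ℕ → ℝ → ℝ := fun i t => σ ^ (i + 1) * iteratedDeriv (i + 1) ρ (σ * t) with hR
  have hmem : ∀ t ∈ Set.Icc (-3 : ℝ) 3, |σ * t| ≤ σ * 3 := by
    intro t ht
    rw [abs_mul, abs_of_pos hσ0]
    exact mul_le_mul_of_nonneg_left (abs_le.2 ht) hσ0.le
  have hmem' : ∀ t ∈ Set.Icc (-3 : ℝ) 3, σ * t ∈ Metric.ball (0 : ℝ) r := by
    intro t ht
    rw [mem_ball_zero_iff, Real.norm_eq_abs]
    linarith [hmem t ht]
  have hρd : ∀ i, ∀ t ∈ Set.Icc (-3 : ℝ) 3, HasDerivAt (fun t => iteratedDeriv i ρ (σ * t))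
      (σ * iteratedDeriv (i + 1) ρ (σ * t)) t := by
    intro i t ht
    have hd : DifferentiableAt ℝ (iteratedDeriv i ρ) (σ * t) := by
      rw [iteratedDeriv_eq_iterate]
      exact ((hana _ (hmem' t ht)).iterated_deriv i).differentiableAt
    have h1 := hd.hasDerivAt
    rw [← iteratedDeriv_succ] at h1
    have h2 := h1.comp t ((hasDerivAt_id t).const_mul σ)
    exact h2.congr_deriv (by ring)
  have hphase : ∀ t, φ (σ * t) + ∑ p ∈ Finset.Ico 1 (q + 1), ψ p u * (σ * t) ^ p
      = a 0 + ∑ p ∈ Finset.range q, (a (p + 1) + ψ (p + 1) u) * σ ^ (p + 1) * t ^ (p + 1)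
        + iteratedDeriv 0 ρ (σ * t) := by
    intro t
    rw [hφeq, Finset.sum_range_succ', Finset.sum_Ico_eq_sum_range, iteratedDeriv_zero]
    have : ∑ p ∈ Finset.range q, (a (p + 1) + ψ (p + 1) u) * σ ^ (p + 1) * t ^ (p + 1)
        = ∑ p ∈ Finset.range q, a (p + 1) * (σ * t) ^ (p + 1)
          + ∑ p ∈ Finset.range (q + 1 - 1), ψ (1 + p) u * (σ * t) ^ (1 + p) := by
      rw [Nat.add_sub_cancel, ← Finset.sum_add_distrib]
      refine Finset.sum_congr rfl fun p _ => ?_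
      rw [add_comm 1 p, mul_pow]
      ring
    rw [this]
    ring
  have hF : ∀ t ∈ Set.Icc (-3 : ℝ) 3,
      HasDerivAt (fun t => φ (σ * t) + ∑ p ∈ Finset.Ico 1 (q + 1), ψ p u * (σ * t) ^ p)
        (powSumDeriv c q 0 t + R 0 t) t := by
    intro t ht
    simp_rw [hphase]
    refine (((HasDerivAt.fun_sum fun p _ => (hasDerivAt_pow (p + 1) t).const_mul
      ((a (p + 1) + ψ (p + 1) u) * σ ^ (p + 1))).const_add (a 0)).add (hρd 0 t ht)).congr_deriv ?_
    rw [powSumDeriv_zero]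
    simp only [hR, hc]
    congr 1
    · refine Finset.sum_congr rfl fun p _ => ?_
      push_cast
      ring
    · ring
  have hRd : ∀ i, ∀ t ∈ Set.Icc (-3 : ℝ) 3, HasDerivAt (R i) (R (i + 1) t) t := by
    intro i t ht
    refine ((hρd (i + 1) t ht).const_mul (σ ^ (i + 1))).congr_deriv ?_
    simp only [hR]
    ring
  have hRbound : ∀ i ≤ n, ∀ t ∈ Set.Icc (-3 : ℝ) 3,
      |R i t| ≤ 4 * 3 ^ n * (b * σ ^ (n + 1)) := by
    intro i hi t ht
    simp only [hR]
    rw [abs_mul, abs_of_pos (pow_pos hσ0 _)]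
    have h1 : |σ * t| ^ (n + 1 - (i + 1)) ≤ (σ * 3) ^ (n - i) := by
      rw [Nat.add_sub_add_right]
      exact pow_le_pow_left₀ (abs_nonneg _) (hmem t ht) _
    have h2 : (3 : ℝ) ^ (n - i) ≤ 3 ^ n := pow_le_pow_right₀ (by norm_num) (by omega)
    calc σ ^ (i + 1) * |iteratedDeriv (i + 1) ρ (σ * t)|
        ≤ σ ^ (i + 1) * (4 * b * (σ * 3) ^ (n - i)) := by
          gcongr
          refine (hup (i + 1) (by omega) _ (hmem' t ht)).trans ?_
          gcongr
      _ = 4 * 3 ^ (n - i) * (b * (σ ^ (i + 1) * σ ^ (n - i))) := by rw [mul_pow]; ring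
      _ = 4 * 3 ^ (n - i) * (b * σ ^ (n + 1)) := by
          rw [← pow_add, show i + 1 + (n - i) = n + 1 by omega]
      _ ≤ _ := by gcongr
  have hzero : ∀ t : ℝ, 2 < |t| → Φ t = 0 := by
    intro t ht
    by_contra h
    linarith [(hsupp t h).2]
  have hmain := hdecay _ Φ (deriv Φ) c R (b * σ ^ (n + 1)) lam (by positivity) hF hRd
    (fun t ht => by
      simp only [hR]
      rw [abs_mul, abs_of_pos (pow_pos hσ0 _), mul_comm]
      exact mul_le_mul_of_nonneg_left (hlow _ (hmem' t ht)) (by positivity))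
    (hRbound 0 (by omega)) (hRbound 1 (by omega))
    (fun t => (hΦ.differentiable (by simp) t).hasDerivAt)
    (hΦ.continuous_deriv (by simp)) (fun t => (hΦb t).1) (fun t => (hΦb t).2)
    (hzero _ (by norm_num)) (hzero _ (by norm_num))
  set A := ∑ p ∈ Finset.range q, |c p| + b * σ ^ (n + 1) with hA
  have hcA : c₀ * |u| ^ ℓr * σ ^ pr ≤ A := by
    have h1 : |c (pr - 1)| ≤ A := by
      have := Finset.single_le_sum (f := fun p => |c p|) (fun p _ => abs_nonneg _)
        (Finset.mem_range.2 (show pr - 1 < q by omega))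
      have h2 : 0 ≤ b * σ ^ (n + 1) := by positivity
      linarith
    refine le_trans ?_ h1
    simp only [hc]
    rw [← Nat.cast_add_one, Nat.sub_add_cancel hpr1, abs_mul, abs_mul, Nat.abs_cast, abs_pow,
      abs_of_pos hσ0]
    refine le_trans ?_ (le_mul_of_one_le_right (by positivity) (by exact_mod_cast hpr1))
    exact mul_le_mul_of_nonneg_right (hψlow u hu) (by positivity)
  have hscale : (2 : ℝ) ^ ((ℓr : ℤ) * k) ≤ 2 ^ ℓr * |u| ^ ℓr := by
    rw [mul_comm (ℓr : ℤ) k, zpow_mul, zpow_natCast, ← mul_pow]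
    refine pow_le_pow_left₀ (by positivity) ?_ _
    rw [zpow_sub_one₀ (by norm_num)] at hu1
    linarith
  have hσpr : (2 : ℝ) ^ ((pr : ℤ) * j) = σ ^ pr := by
    rw [mul_comm (pr : ℤ) j, zpow_mul, zpow_natCast]
  have hX : |lam| * (2 : ℝ) ^ ((ℓr : ℤ) * k) * (2 : ℝ) ^ ((pr : ℤ) * j)
      ≤ 2 ^ ℓr / c₀ * (|lam| * A) := by
    rw [hσpr]
    calc |lam| * (2 : ℝ) ^ ((ℓr : ℤ) * k) * σ ^ pr
        ≤ |lam| * (2 ^ ℓr * |u| ^ ℓr) * σ ^ pr := by gcongr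
      _ = 2 ^ ℓr / c₀ * (|lam| * (c₀ * |u| ^ ℓr * σ ^ pr)) := by field_simp
      _ ≤ _ := by gcongr
  have hA0 : 0 ≤ A := le_trans (by positivity) hcA
  calc _ ≤ _ * (2 ^ ℓr / c₀ * (|lam| * A)) ^ ε :=
        mul_le_mul_of_nonneg_left (Real.rpow_le_rpow (by positivity) hX hε.le) (norm_nonneg _)
    _ = _ * (|lam| * A) ^ ε * (2 ^ ℓr / c₀) ^ ε := by
        rw [Real.mul_rpow (by positivity) (by positivity)]
        ring
    _ ≤ _ := mul_le_mul_of_nonneg_right hmain (by positivity)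
end
end
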